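/- Let $0 < q < p \le r \le 1$, and let $u, v, w$ be weights on $(a,b)$ with $0 < \int_x^b w < \infty$ for all $x \in (a,b)$. Then $\big(\int_a^b \big(\int_a^t f^r v\big)^{q/r} u\,dt\big)^{1/q} \le C \big(\int_a^b \big(\int_a^t f\big)^{p} w\,dt\big)^{1/p}$ holds for all nonnegative measurable $f$ if and only if both $C_4 := \big(\int_a^b \big(\int_x^b u\big)^{q/(p-q)} u(x)\, \operatorname{ess\,sup}_{t\in(a,x)} \big(\int_t^b w\big)^{-q/(p-q)} V_r(t,x)^{pq/(p-q)}\, dx\big)^{(p-q)/(pq)}$ and $C_5 := \big(\int_a^b w(x) \sup_{y\in(a,x)} \big(\int_y^b w\big)^{-p/(p-q)} \big(\int_y^x \big(\int_t^x u\big)^{q/(1-q)} u(t)\, V_r(y,t)^{q/(1-q)}\, dt\big)^{p(1-q)/(p-q)} dx\big)^{(p-q)/(pq)}$ are finite; moreover, the best constant satisfies $C \approx C_4 + C_5$. -/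

import Mathlib

open MeasureTheory Set ENNReal

noncomputable section

/-- `w` is a weight on `(a,b)`: measurable, positive and finite there. -/
def IsWeight (a b : ℝ) (w : ℝ → ℝ≥0∞) : Prop :=
  Measurable w ∧ ∀ x ∈ Set.Ioo a b, 0 < w x ∧ w x < ∞

/-- The quantity `V_r(x,t)`: `(∫_x^t v^{1/(1-r)})^{(1-r)/r}` for `0 < r < 1`,
and `ess sup_{(x,t)} v` for `r = 1`. -/
def Vr (r : ℝ) (v : ℝ → ℝ≥0∞) (x t : ℝ) : ℝ≥0∞ :=
  if r = 1 then essSup v (volume.restrict (Set.Ioo x t))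
  else (∫⁻ s in Set.Ioo x t, v s ^ (1 / (1 - r))) ^ ((1 - r) / r)

/-- The Cesàro–Cesàro inequality (2.2) with constant `C`:
`(∫_a^b (∫_a^t f^r v)^{q/r} u dt)^{1/q} ≤ C (∫_a^b (∫_a^t f)^p w dt)^{1/p}`
for all nonnegative measurable `f` on `(a,b)`. -/
def CesCesIneq (a b r p q : ℝ) (u v w : ℝ → ℝ≥0∞) (C : ℝ≥0∞) : Prop :=
  ∀ f : ℝ → ℝ≥0∞, Measurable f →
    (∫⁻ t in Set.Ioo a b, (∫⁻ s in Set.Ioo a t, f s ^ r * v s) ^ (q / r) * u t) ^ (1 / q) ≤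
      C * (∫⁻ t in Set.Ioo a b, (∫⁻ s in Set.Ioo a t, f s) ^ p * w t) ^ (1 / p)

/-- The best (least) constant in the Cesàro–Cesàro inequality. -/
def BestC (a b r p q : ℝ) (u v w : ℝ → ℝ≥0∞) : ℝ≥0∞ :=
  sInf {C | CesCesIneq a b r p q u v w C}

def C₁ (a b r p q : ℝ) (u v w : ℝ → ℝ≥0∞) : ℝ≥0∞ :=
  essSup (fun x => (∫⁻ t in Set.Ioo x b, w t) ^ (-(1 / p)) *
      essSup (fun t => (∫⁻ s in Set.Ioo t b, u s) ^ (1 / q) * Vr r v x t)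
        (volume.restrict (Set.Ioo x b)))
    (volume.restrict (Set.Ioo a b))

def C₂ (a b r p q : ℝ) (u v w : ℝ → ℝ≥0∞) : ℝ≥0∞ :=
  ⨆ x ∈ Set.Ioo a b, (∫⁻ t in Set.Ioo x b, w t) ^ (-(1 / p)) *
    (∫⁻ t in Set.Ioo x b,
        (∫⁻ s in Set.Ioo t b, u s) ^ (q / (1 - q)) * u t * Vr r v x t ^ (q / (1 - q))) ^
      ((1 - q) / q)

def C₃ (a b r p q : ℝ) (u v w : ℝ → ℝ≥0∞) : ℝ≥0∞ :=
  ⨆ x ∈ Set.Ioo a b, (∫⁻ t in Set.Ioo x b, u t) ^ (1 / q) *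
    (∫⁻ t in Set.Ioo a x,
        (∫⁻ s in Set.Ioo t b, w s) ^ (-(p / (p - r))) * w t * Vr r v t x ^ (p * r / (p - r))) ^
      ((p - r) / (p * r))

def C₄ (a b r p q : ℝ) (u v w : ℝ → ℝ≥0∞) : ℝ≥0∞ :=
  (∫⁻ x in Set.Ioo a b, (∫⁻ s in Set.Ioo x b, u s) ^ (q / (p - q)) * u x *
      essSup (fun t => (∫⁻ s in Set.Ioo t b, w s) ^ (-(q / (p - q))) *
          Vr r v t x ^ (p * q / (p - q)))
        (volume.restrict (Set.Ioo a x))) ^ ((p - q) / (p * q))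

def C₅ (a b r p q : ℝ) (u v w : ℝ → ℝ≥0∞) : ℝ≥0∞ :=
  (∫⁻ x in Set.Ioo a b, w x *
      ⨆ y ∈ Set.Ioo a x, (∫⁻ s in Set.Ioo y b, w s) ^ (-(p / (p - q))) *
        (∫⁻ t in Set.Ioo y x,
            (∫⁻ s in Set.Ioo t x, u s) ^ (q / (1 - q)) * u t * Vr r v y t ^ (q / (1 - q))) ^
          (p * (1 - q) / (p - q))) ^ ((p - q) / (p * q))

def C₆ (a b r p q : ℝ) (u v w : ℝ → ℝ≥0∞) : ℝ≥0∞ :=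
  (∫⁻ x in Set.Ioo a b, w x *
      essSup (fun y => (∫⁻ s in Set.Ioo y b, w s)⁻¹ *
          (∫⁻ t in Set.Ioo y x, (∫⁻ s in Set.Ioo t b, u s) ^ (q / (p - q)) * u t *
              (∫⁻ s in Set.Ioo a y, (∫⁻ σ in Set.Ioo s b, w σ) ^ (-(p / (p - r))) * w s *
                  Vr r v s y ^ (p * r / (p - r))) ^ ((p - r) * q / ((p - q) * r))))
        (volume.restrict (Set.Ioo a x))) ^ ((p - q) / (p * q))

def C₇ (a b r p q : ℝ) (u v w : ℝ → ℝ≥0∞) : ℝ≥0∞ :=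
  (∫⁻ x in Set.Ioo a b, w x *
      essSup (fun y => (∫⁻ s in Set.Ioo y b, w s) ^ (-(p / (p - q))) *
          essSup (fun t => (∫⁻ s in Set.Ioo t x, u s) ^ (p / (p - q)) *
              Vr r v y t ^ (p * q / (p - q)))
            (volume.restrict (Set.Ioo y x)))
        (volume.restrict (Set.Ioo a x))) ^ ((p - q) / (p * q))

theorem rpow_add_le_two_rpow_mul {γ : ℝ} (hγ : 0 ≤ γ) (x y : ℝ≥0∞) :
    (x + y) ^ γ ≤ 2 ^ γ * (x ^ γ + y ^ γ) := by
  wlog h : y ≤ x generalizing x y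
  · rw [add_comm x, add_comm (x ^ γ)]
    exact this y x (le_of_not_ge h)
  calc (x + y) ^ γ ≤ (2 * x) ^ γ := by
        rw [two_mul]
        gcongr
    _ = 2 ^ γ * x ^ γ := ENNReal.mul_rpow_of_nonneg _ _ hγ
    _ ≤ _ := by gcongr; exact le_self_add

theorem rpow_add_add_le_three_rpow_mul {γ : ℝ} (hγ : 0 ≤ γ) (x y z : ℝ≥0∞) :
    (x + y + z) ^ γ ≤ 3 ^ γ * (x ^ γ + y ^ γ + z ^ γ) := by
  obtain ⟨m, hm, hx, hy, hz⟩ : ∃ m, m ^ γ ≤ x ^ γ + y ^ γ + z ^ γ ∧ x ≤ m ∧ y ≤ m ∧ z ≤ m := by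
    refine ⟨max x (max y z), ?_, le_max_left _ _, (le_max_left _ _).trans (le_max_right _ _),
      (le_max_right _ _).trans (le_max_right _ _)⟩
    rcases max_choice x (max y z) with h | h
    · rw [h]
      exact le_self_add.trans le_self_add
    · rw [h]
      rcases max_choice y z with h' | h'
      · rw [h']
        exact le_add_self.trans le_self_add
      · rw [h']
        exact le_add_self
  calc (x + y + z) ^ γ ≤ (3 * m) ^ γ := by
        gcongr
        calc x + y + z ≤ m + m + m := by gcongr
          _ = 3 * m := by ring
    _ = 3 ^ γ * m ^ γ := ENNReal.mul_rpow_of_nonneg _ _ hγ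
    _ ≤ _ := by gcongr

theorem rpow_sum_le_sum_rpow {ι : Type*} (s : Finset ι) (x : ι → ℝ≥0∞) {γ : ℝ} (h0 : 0 < γ)
    (h1 : γ ≤ 1) : (∑ i ∈ s, x i) ^ γ ≤ ∑ i ∈ s, x i ^ γ := by
  classical
  induction s using Finset.induction_on with
  | empty => simp [h0]
  | insert i s hi ih =>
    rw [Finset.sum_insert hi, Finset.sum_insert hi]
    exact (ENNReal.rpow_add_le_add_rpow _ _ h0.le h1).trans (by gcongr)

theorem rpow_tsum_le_tsum_rpow {ι : Type*} (x : ι → ℝ≥0∞) {γ : ℝ} (h0 : 0 < γ)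
    (h1 : γ ≤ 1) : (∑' i, x i) ^ γ ≤ ∑' i, x i ^ γ := by
  have key : ∑' i, x i ≤ (∑' i, x i ^ γ) ^ (1 / γ) := by
    rw [ENNReal.tsum_eq_iSup_sum]
    refine iSup_le fun s => ?_
    rw [one_div, ENNReal.le_rpow_inv_iff h0]
    exact (rpow_sum_le_sum_rpow s x h0 h1).trans (ENNReal.sum_le_tsum s)
  rwa [one_div, ENNReal.le_rpow_inv_iff h0] at key

/-- Hölder's inequality for series with exponents `1/s` and `1/(1-s)`. -/
theorem tsum_rpow_mul_rpow_le (x y : ℕ → ℝ≥0∞) {s : ℝ} (h0 : 0 ≤ s) (h1 : s ≤ 1) :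
    ∑' k, x k ^ s * y k ^ (1 - s) ≤ (∑' k, x k) ^ s * (∑' k, y k) ^ (1 - s) := by
  have := ENNReal.lintegral_mul_norm_pow_le (μ := Measure.count) (f := x) (g := y)
    (measurable_of_countable _).aemeasurable (measurable_of_countable _).aemeasurable
    h0 (sub_nonneg.2 h1) (by ring)
  simpa [lintegral_count] using this

/-- A discrete Hardy inequality for geometrically decaying weights `g`. -/
theorem tsum_mul_le_of_recursion {c : ℝ≥0∞} {g E s : ℕ → ℝ≥0∞} (hg : ∀ k, 2 * c * g (k + 1) ≤ g k)
    (hE0 : E 0 = 0) (hE : ∀ k, E (k + 1) ≤ c * (E k + s k)) :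
    ∑' k, g k * E (k + 1) ≤ 2 * c * ∑' k, g k * s k := by
  have key : ∀ n, ∑ k ∈ Finset.range n, g k * E (k + 1) + 2 * c * g n * E n ≤
      2 * c * ∑ k ∈ Finset.range n, g k * s k := by
    intro n
    induction n with
    | zero => simp [hE0]
    | succ n ih =>
      rw [Finset.sum_range_succ, Finset.sum_range_succ, mul_add]
      calc _ ≤ ∑ k ∈ Finset.range n, g k * E (k + 1) + g n * E (n + 1) + g n * E (n + 1) := by
            gcongr
            exact hg n
        _ = ∑ k ∈ Finset.range n, g k * E (k + 1) + 2 * g n * E (n + 1) := by ring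
        _ ≤ ∑ k ∈ Finset.range n, g k * E (k + 1) + 2 * g n * (c * (E n + s n)) := by
            gcongr
            exact hE n
        _ = (∑ k ∈ Finset.range n, g k * E (k + 1) + 2 * c * g n * E n)
              + 2 * c * (g n * s n) := by ring
        _ ≤ _ := by gcongr
  rw [ENNReal.tsum_eq_iSup_nat]
  refine iSup_le fun n => le_self_add.trans ((key n).trans ?_)
  gcongr
  exact ENNReal.sum_le_tsum _

theorem le_rpow_of_le_mul_rpow {S X : ℝ≥0∞} (hS : S ≠ ∞) {s : ℝ} (h1 : s < 1)
    (h : S ≤ X * S ^ s) : S ≤ X ^ (1 / (1 - s)) := by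
  have hs : 0 < 1 - s := by linarith
  rcases eq_or_ne S 0 with rfl | hS0
  · simp
  rw [one_div, ENNReal.le_rpow_inv_iff hs, ENNReal.rpow_sub _ _ hS0 hS, ENNReal.rpow_one]
  exact ENNReal.div_le_of_le_mul h

theorem tsum_le_rpow_of_sum_le {B : ℕ → ℝ≥0∞} (hB : ∀ k, B k ≠ ∞) {X : ℝ≥0∞} {s : ℝ}
    (h1 : s < 1)
    (h : ∀ n, ∑ k ∈ Finset.range n, B k ≤ X * (∑ k ∈ Finset.range n, B k) ^ s) :
    ∑' k, B k ≤ X ^ (1 / (1 - s)) := by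
  rw [ENNReal.tsum_eq_iSup_nat]
  exact iSup_le fun n => le_rpow_of_le_mul_rpow (ENNReal.sum_ne_top.2 fun k _ => hB k) h1 (h n)

theorem lintegral_Ioo_add_Ioo (g : ℝ → ℝ≥0∞) {x y z : ℝ} (hxy : x ≤ y) (hyz : y ≤ z) :
    ∫⁻ t in Ioo x z, g t = (∫⁻ t in Ioo x y, g t) + ∫⁻ t in Ioo y z, g t := by
  rw [setLIntegral_congr (Ioo_ae_eq_Ioc (μ := volume) (a := x) (b := z)),
    setLIntegral_congr (Ioo_ae_eq_Ioc (μ := volume) (a := x) (b := y)),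
    setLIntegral_congr (Ioo_ae_eq_Ioc (μ := volume) (a := y) (b := z)),
    ← Ioc_union_Ioc_eq_Ioc hxy hyz, lintegral_union measurableSet_Ioc]
  exact Ioc_disjoint_Ioc_of_le le_rfl

theorem lintegral_Ico_eq_Ioo (g : ℝ → ℝ≥0∞) (x y : ℝ) :
    ∫⁻ t in Ico x y, g t = ∫⁻ t in Ioo x y, g t :=
  setLIntegral_congr Ioo_ae_eq_Ico.symm

/-- An increasing sequence of points of `[α, β)` which starts at `α` and exhausts `[α, β)`. -/
structure IsPartition (t : ℕ → ℝ) (α β : ℝ) : Prop where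
  strictMono : StrictMono t
  zero : t 0 = α
  lt (k : ℕ) : t k < β
  exists_lt {x : ℝ} (hx : x < β) : ∃ k, x < t k

namespace IsPartition

variable {t : ℕ → ℝ} {α β : ℝ}

theorem le (ht : IsPartition t α β) (k : ℕ) : α ≤ t k :=
  ht.zero ▸ ht.strictMono.monotone (Nat.zero_le k)

theorem lt_succ (ht : IsPartition t α β) (k : ℕ) : t k < t (k + 1) :=
  ht.strictMono k.lt_succ_self

theorem mem (ht : IsPartition t α β) (k : ℕ) : t k ∈ Ico α β := ⟨ht.le k, ht.lt k⟩

theorem iUnion_Ico (ht : IsPartition t α β) : ⋃ k, Ico (t k) (t (k + 1)) = Ico α β := by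
  ext x
  simp only [mem_iUnion, mem_Ico]
  constructor
  · rintro ⟨k, h1, h2⟩
    exact ⟨(ht.le k).trans h1, h2.trans (ht.lt _)⟩
  · rintro ⟨h1, h2⟩
    classical
    have hex := ht.exists_lt h2
    have hs := Nat.find_spec hex
    obtain ⟨k, hk⟩ : ∃ k, Nat.find hex = k + 1 := by
      refine Nat.exists_eq_succ_of_ne_zero fun h0 => ?_
      rw [h0, ht.zero] at hs
      exact absurd hs (not_lt.2 h1)
    rw [hk] at hs
    exact ⟨k, not_lt.1 (Nat.find_min hex (by omega)), hs⟩

theorem disjoint_Ico (ht : IsPartition t α β) :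
    Pairwise (Function.onFun Disjoint fun k => Ico (t k) (t (k + 1))) :=
  ht.strictMono.monotone.pairwise_disjoint_on_Ico_succ

theorem tsum_measure (ht : IsPartition t α β) (ρ : Measure ℝ) :
    ∑' k, ρ (Ico (t k) (t (k + 1))) = ρ (Ico α β) := by
  rw [← ht.iUnion_Ico, measure_iUnion ht.disjoint_Ico fun _ => measurableSet_Ico]

theorem tsum_lintegral (ht : IsPartition t α β) (g : ℝ → ℝ≥0∞) :
    ∑' k, ∫⁻ x in Ioo (t k) (t (k + 1)), g x = ∫⁻ x in Ioo α β, g x := by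
  rw [← lintegral_Ico_eq_Ioo, ← ht.iUnion_Ico,
    lintegral_iUnion (fun _ => measurableSet_Ico) ht.disjoint_Ico]
  simp_rw [lintegral_Ico_eq_Ioo]

theorem tsum_lintegral_succ_le (ht : IsPartition t α β) (g : ℝ → ℝ≥0∞) :
    ∑' k, ∫⁻ x in Ioo (t (k + 1)) (t (k + 1 + 1)), g x ≤ ∫⁻ x in Ioo α β, g x := by
  rw [← ht.tsum_lintegral]
  exact ENNReal.tsum_comp_le_tsum_of_injective (add_left_injective 1)
    fun k => ∫⁻ x in Ioo (t k) (t (k + 1)), g x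

end IsPartition

/-- `g` has positive integral near `β` and finite integral over `(α, β)`. -/
structure HasTails (g : ℝ → ℝ≥0∞) (α β : ℝ) : Prop where
  lt : α < β
  meas : Measurable g
  pos {x : ℝ} (hx : x ∈ Ico α β) : 0 < ∫⁻ t in Ioo x β, g t
  fin : ∫⁻ t in Ioo α β, g t < ∞

namespace HasTails

variable {g : ℝ → ℝ≥0∞} {α β : ℝ}

theorem lintegral_ne_top (hg : HasTails g α β) {x : ℝ} (hx : α ≤ x) (y : ℝ) (hy : y ≤ β) :
    ∫⁻ t in Ioo x y, g t ≠ ∞ :=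
  ((lintegral_mono_set (Ioo_subset_Ioo hx hy)).trans_lt hg.fin).ne

theorem mono_left (hg : HasTails g α β) {x : ℝ} (hx : x ∈ Ico α β) : HasTails g x β :=
  ⟨hx.2, hg.meas, fun hy => hg.pos ⟨hx.1.trans hy.1, hy.2⟩,
    (hg.lintegral_ne_top hx.1 _ le_rfl).lt_top⟩

theorem exists_eq (hg : HasTails g α β) {c : ℝ≥0∞} (hc : c ≤ ∫⁻ t in Ioo α β, g t) :
    ∃ x ∈ Icc α β, ∫⁻ t in Ioo x β, g t = c := by
  have hfin := hg.fin.ne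
  have hint : IntegrableOn (fun t => (g t).toReal) (uIcc α β) := by
    rw [uIcc_of_le hg.lt.le, integrableOn_Icc_iff_integrableOn_Ioo]
    exact integrable_toReal_of_lintegral_ne_top hg.meas.aemeasurable hfin
  have hval : ∀ x ∈ Icc α β, ∫ t in x..β, (g t).toReal = (∫⁻ t in Ioo x β, g t).toReal := by
    intro x hx
    rw [intervalIntegral.integral_of_le hx.2, integral_Ioc_eq_integral_Ioo]
    refine integral_toReal hg.meas.aemeasurable ?_
    exact ae_lt_top hg.meas (hg.lintegral_ne_top hx.1 _ le_rfl)
  have hcont : ContinuousOn (fun x => (∫⁻ t in Ioo x β, g t).toReal) (Icc α β) := by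
    have := intervalIntegral.continuousOn_primitive_interval_left hint
    rw [uIcc_of_le hg.lt.le] at this
    exact this.congr fun x hx => (hval x hx).symm
  have hmem : c.toReal ∈ Icc ((fun x => (∫⁻ t in Ioo x β, g t).toReal) β)
      ((fun x => (∫⁻ t in Ioo x β, g t).toReal) α) := by
    simp only [Ioo_self, Measure.restrict_empty, lintegral_zero_measure, toReal_zero, mem_Icc,
      toReal_nonneg, true_and]
    exact ENNReal.toReal_mono hfin hc
  obtain ⟨x, hx, hxc⟩ := intermediate_value_Icc' hg.lt.le hcont hmem
  refine ⟨x, hx, ?_⟩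
  exact (ENNReal.toReal_eq_toReal_iff' (hg.lintegral_ne_top hx.1 _ le_rfl)
    (ne_top_of_le_ne_top hfin hc)).1 hxc

theorem exists_mul_eq (hg : HasTails g α β) {K : ℝ≥0∞} (hK : 1 < K) (hK' : K ≠ ∞) :
    ∃ x ∈ Ioo α β, K * ∫⁻ t in Ioo x β, g t = ∫⁻ t in Ioo α β, g t := by
  have hK0 : K ≠ 0 := (zero_lt_one.trans hK).ne'
  have hpos := (hg.pos ⟨le_rfl, hg.lt⟩).ne'
  obtain ⟨x, hx, hxc⟩ := hg.exists_eq (c := K⁻¹ * ∫⁻ t in Ioo α β, g t)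
    (mul_le_of_le_one_left' (ENNReal.inv_le_one.2 hK.le))
  have h : K * ∫⁻ t in Ioo x β, g t = ∫⁻ t in Ioo α β, g t := by
    rw [hxc, ← mul_assoc, ENNReal.mul_inv_cancel hK0 hK', one_mul]
  refine ⟨x, ⟨lt_of_le_of_ne hx.1 ?_, lt_of_le_of_ne hx.2 ?_⟩, h⟩
  · rintro rfl
    have : 1 * ∫⁻ t in Ioo α β, g t < K * ∫⁻ t in Ioo α β, g t :=
      ENNReal.mul_lt_mul_left hpos hg.fin.ne hK
    rw [h, one_mul] at this
    exact this.false
  · rintro rfl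
    simp at h
    exact hpos h.symm

/-- The points at which the tail integral of `g` drops by the factor `K`. -/
theorem exists_partition (hg : HasTails g α β) {K : ℝ≥0∞} (hK : 2 ≤ K) (hK' : K ≠ ∞) :
    ∃ t, IsPartition t α β ∧
      ∀ k, K * ∫⁻ x in Ioo (t (k + 1)) β, g x = ∫⁻ x in Ioo (t k) β, g x := by
  have hK1 : 1 < K := ENNReal.one_lt_two.trans_le hK
  have hstep : ∀ x : Ico α β, ∃ y : Ico α β, x.1 < y.1 ∧
      K * ∫⁻ t in Ioo y.1 β, g t = ∫⁻ t in Ioo x.1 β, g t := by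
    rintro ⟨x, hx⟩
    obtain ⟨y, hy, h⟩ := (hg.mono_left hx).exists_mul_eq hK1 hK'
    exact ⟨⟨y, hx.1.trans hy.1.le, hy.2⟩, hy.1, h⟩
  choose F hF1 hF2 using hstep
  let s : ℕ → Ico α β := fun n => F^[n] ⟨α, le_rfl, hg.lt⟩
  have hs : ∀ n, s (n + 1) = F (s n) := fun n => Function.iterate_succ_apply' _ _ _
  have hG : ∀ n, K ^ n * ∫⁻ x in Ioo (s n).1 β, g x = ∫⁻ x in Ioo α β, g x := by
    intro n
    induction n with
    | zero => simp [s]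
    | succ n ih => rw [pow_succ, mul_assoc, hs, hF2, ih]
  refine ⟨fun n => (s n).1, ⟨strictMono_nat_of_lt_succ fun n => ?_, rfl, fun n => (s n).2.2,
    fun {x} hx => ?_⟩, fun n => ?_⟩
  · rw [hs]
    exact hF1 _
  · by_contra! hcon
    have hx' : x ∈ Ico α β := ⟨hcon 0, hx⟩
    have hle : ∀ n, K ^ n * ∫⁻ t in Ioo x β, g t ≤ ∫⁻ t in Ioo α β, g t := by
      intro n
      rw [← hG n]
      gcongr
      exact hcon n
    have htend := ENNReal.tendsto_pow_atTop_nhds_top_iff.2 hK1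
    have htend' := ENNReal.Tendsto.mul_const (b := ∫⁻ t in Ioo x β, g t) htend
      (Or.inl ENNReal.top_ne_zero)
    rw [ENNReal.top_mul (hg.pos hx').ne'] at htend'
    exact hg.fin.not_ge (le_of_tendsto' htend' hle)
  · simp only [hs, hF2]

theorem lintegral_le_of_level (hg : HasTails g α β) {x y : ℝ} (hx : α ≤ x) (hxy : x ≤ y)
    (hy : y ≤ β) {K : ℝ≥0∞} (hK : 2 ≤ K)
    (h : K * ∫⁻ t in Ioo y β, g t = ∫⁻ t in Ioo x β, g t) :
    ∫⁻ t in Ioo y β, g t ≤ ∫⁻ t in Ioo x y, g t := by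
  have h1 := lintegral_Ioo_add_Ioo g hxy hy
  rw [← h] at h1
  have h2 : (∫⁻ t in Ioo y β, g t) + ∫⁻ t in Ioo y β, g t ≤
      (∫⁻ t in Ioo x y, g t) + ∫⁻ t in Ioo y β, g t := by
    rw [← h1, ← two_mul]
    gcongr
  exact (ENNReal.add_le_add_iff_right (hg.lintegral_ne_top (hx.trans hxy) _ le_rfl)).1 h2

end HasTails

/-- A lower bound for the integral of powers of the tails of `g`. -/
theorem HasTails.rpow_le_lintegral {g : ℝ → ℝ≥0∞} {α β : ℝ} (hg : HasTails g α β) {l : ℝ}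
    (hl : 0 ≤ l) :
    (∫⁻ t in Ioo α β, g t) ^ (l + 1) ≤
      2 ^ (l + 1) * ∫⁻ t in Ioo α β, (∫⁻ s in Ioo t β, g s) ^ l * g t := by
  obtain ⟨x, hx, h⟩ := hg.exists_mul_eq (K := 2) ENNReal.one_lt_two (by simp)
  have hle := hg.lintegral_le_of_level le_rfl hx.1.le hx.2.le le_rfl h
  rw [← h, ENNReal.mul_rpow_of_nonneg _ _ (by linarith)]
  gcongr
  rw [ENNReal.rpow_add_of_nonneg _ _ hl zero_le_one, ENNReal.rpow_one]
  calc (∫⁻ t in Ioo x β, g t) ^ l * ∫⁻ t in Ioo x β, g t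
      ≤ (∫⁻ t in Ioo x β, g t) ^ l * ∫⁻ t in Ioo α x, g t := by gcongr
    _ ≤ ∫⁻ t in Ioo α x, (∫⁻ s in Ioo x β, g s) ^ l * g t := lintegral_const_mul_le _ _
    _ ≤ ∫⁻ t in Ioo α x, (∫⁻ s in Ioo t β, g s) ^ l * g t := by
        refine setLIntegral_mono' measurableSet_Ioo fun t ht => ?_
        gcongr
        exact ht.2.le
    _ ≤ _ := lintegral_mono_set (Ioo_subset_Ioo_right hx.2.le)

/-- A weight is integrated over a nonempty interval with a positive result. -/
theorem lintegral_Ioo_pos {g : ℝ → ℝ≥0∞} (hg : Measurable g) {x y : ℝ} (hxy : x < y)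
    (h : ∀ t ∈ Ioo x y, 0 < g t) : 0 < ∫⁻ t in Ioo x y, g t := by
  rw [setLIntegral_pos_iff hg]
  refine lt_of_lt_of_le ?_ (measure_mono (s := Ioo x y) fun t ht => ⟨(h t ht).ne', ht⟩)
  simpa using hxy

theorem hasTails_of_pos {g : ℝ → ℝ≥0∞} {α β : ℝ} (hαβ : α < β) (hg : Measurable g)
    (h : ∀ t ∈ Ioo α β, 0 < g t) (hfin : ∫⁻ t in Ioo α β, g t < ∞) : HasTails g α β :=
  ⟨hαβ, hg, fun hx => lintegral_Ioo_pos hg hx.2 fun t ht => h t ⟨hx.1.trans_lt ht.1, ht.2⟩, hfin⟩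

theorem Vr_one (v : ℝ → ℝ≥0∞) (x t : ℝ) :
    Vr 1 v x t = essSup v (volume.restrict (Ioo x t)) := if_pos rfl

theorem Vr_of_lt_one {r : ℝ} (hr : r < 1) (v : ℝ → ℝ≥0∞) (x t : ℝ) :
    Vr r v x t = (∫⁻ s in Ioo x t, v s ^ (1 / (1 - r))) ^ ((1 - r) / r) := if_neg hr.ne

theorem Vr_mono {r : ℝ} (hr0 : 0 < r) (hr1 : r ≤ 1) (v : ℝ → ℝ≥0∞) {x t x' t' : ℝ} (hx : x' ≤ x)
    (ht : t ≤ t') : Vr r v x t ≤ Vr r v x' t' := by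
  have hsub : Ioo x t ⊆ Ioo x' t' := Ioo_subset_Ioo hx ht
  rcases hr1.eq_or_lt with rfl | hr
  · rw [Vr_one, Vr_one]
    exact essSup_mono_measure' (Measure.restrict_mono_set _ hsub)
  · rw [Vr_of_lt_one hr, Vr_of_lt_one hr]
    exact ENNReal.rpow_le_rpow (lintegral_mono_set hsub) (div_nonneg (by linarith) hr0.le)

theorem Vr_le_add {r : ℝ} (hr0 : 0 < r) (hr1 : r ≤ 1) (v : ℝ → ℝ≥0∞) {x y t : ℝ} (hxy : x ≤ y)
    (hyt : y ≤ t) : Vr r v x t ≤ 2 ^ ((1 - r) / r) * (Vr r v x y + Vr r v y t) := by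
  rcases hr1.eq_or_lt with rfl | hr
  · simp only [Vr_one, sub_self, zero_div, ENNReal.rpow_zero, one_mul]
    refine essSup_le_of_ae_le _ ?_
    have h1 := (ae_restrict_iff' measurableSet_Ioo).1
      (ENNReal.ae_le_essSup (μ := volume.restrict (Ioo x y)) v)
    have h2 := (ae_restrict_iff' measurableSet_Ioo).1
      (ENNReal.ae_le_essSup (μ := volume.restrict (Ioo y t)) v)
    have h3 : ∀ᵐ s ∂(volume : Measure ℝ), s ≠ y := by simp [ae_iff]
    refine (ae_restrict_iff' measurableSet_Ioo).2 ?_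
    filter_upwards [h1, h2, h3] with s hs1 hs2 hs3 hs
    rcases lt_or_gt_of_ne hs3 with h | h
    · exact (hs1 ⟨hs.1, h⟩).trans le_self_add
    · exact (hs2 ⟨h, hs.2⟩).trans le_add_self
  · simp only [Vr_of_lt_one hr]
    rw [lintegral_Ioo_add_Ioo _ hxy hyt]
    exact rpow_add_le_two_rpow_mul (div_nonneg (by linarith) hr0.le) _ _

theorem lintegral_rpow_mul_le_Vr {r : ℝ} (hr0 : 0 < r) (hr1 : r ≤ 1) {f v : ℝ → ℝ≥0∞}
    (hf : Measurable f) (hv : Measurable v) (x y : ℝ) :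
    ∫⁻ s in Ioo x y, f s ^ r * v s ≤ ((∫⁻ s in Ioo x y, f s) * Vr r v x y) ^ r := by
  rcases hr1.eq_or_lt with rfl | hr
  · simp only [ENNReal.rpow_one]
    rw [Vr_one, ← lintegral_mul_const _ hf]
    refine lintegral_mono_ae ?_
    filter_upwards [ENNReal.ae_le_essSup (μ := volume.restrict (Ioo x y)) v] with s hs
    gcongr
  · have h1r : 0 < 1 - r := by linarith
    have h := ENNReal.lintegral_mul_norm_pow_le (μ := volume.restrict (Ioo x y)) (f := f)
      (g := fun s => v s ^ (1 / (1 - r))) hf.aemeasurable (hv.pow_const _).aemeasurable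
      hr0.le h1r.le (by ring)
    rw [Vr_of_lt_one hr, ENNReal.mul_rpow_of_nonneg _ _ hr0.le, ← ENNReal.rpow_mul,
      div_mul_cancel₀ _ hr0.ne']
    refine le_trans (le_of_eq ?_) h
    refine lintegral_congr fun s => ?_
    rw [← ENNReal.rpow_mul, one_div, inv_mul_cancel₀ h1r.ne', ENNReal.rpow_one]

theorem Vr_pos {r : ℝ} (hr0 : 0 < r) (hr1 : r ≤ 1) {v : ℝ → ℝ≥0∞} (hv : Measurable v) {x y : ℝ}
    (hxy : x < y) (hpos : ∀ t ∈ Ioo x y, 0 < v t) : 0 < Vr r v x y := by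
  have h0 : 0 < ∫⁻ t in Ioo x y, v t := lintegral_Ioo_pos hv hxy hpos
  have h := lintegral_rpow_mul_le_Vr hr0 hr1 (f := fun _ => 1) measurable_const hv x y
  simp only [ENNReal.one_rpow, one_mul] at h
  by_contra! hcon
  rw [nonpos_iff_eq_zero.1 hcon, mul_zero, ENNReal.zero_rpow_of_pos hr0] at h
  exact absurd h (not_le.2 h0)

/-- Sharpness of the weighted Hölder inequality `lintegral_rpow_mul_le_Vr`. -/
theorem exists_rpow_le_lintegral_of_lt_Vr {r : ℝ} (hr0 : 0 < r) (hr1 : r ≤ 1) {v : ℝ → ℝ≥0∞}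
    (hv : Measurable v) {x y : ℝ} (hfin : ∀ t ∈ Ioo x y, v t ≠ ∞) {X : ℝ≥0∞}
    (hX : X < Vr r v x y) :
    ∃ f : ℝ → ℝ≥0∞, Measurable f ∧ (∀ t, t ∉ Ioo x y → f t = 0) ∧ ∫⁻ t, f t ≤ 1 ∧
      X ^ r ≤ ∫⁻ t in Ioo x y, f t ^ r * v t := by
  rcases hr1.eq_or_lt with rfl | hr
  · rw [Vr_one] at hX
    let E : Set ℝ := {t | X < v t} ∩ Ioo x y
    have hE : MeasurableSet E := (measurableSet_lt measurable_const hv).inter measurableSet_Ioo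
    have hE0 : volume E ≠ 0 := by
      intro h0
      refine absurd hX (not_lt.2 (essSup_le_of_ae_le _ ?_))
      rw [Filter.EventuallyLE, ae_restrict_iff' measurableSet_Ioo, ae_iff]
      refine measure_mono_null (fun t ht => ?_) h0
      simp only [mem_ofPred_eq, Classical.not_imp, not_le] at ht
      exact ⟨ht.2, ht.1⟩
    have hEt : volume E ≠ ∞ := by
      refine ((measure_mono (t := Ioo x y) inter_subset_right).trans_lt ?_).ne
      simp
    refine ⟨E.indicator fun _ => (volume E)⁻¹, measurable_const.indicator hE,
      fun t ht => indicator_of_notMem (fun h => ht h.2) _, ?_, ?_⟩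
    · rw [lintegral_indicator hE, setLIntegral_const, ENNReal.inv_mul_cancel hE0 hEt]
    · simp only [ENNReal.rpow_one]
      calc X = ∫⁻ t in E, (volume E)⁻¹ * X := by
            rw [setLIntegral_const, mul_right_comm, ENNReal.inv_mul_cancel hE0 hEt, one_mul]
        _ ≤ ∫⁻ t in E, E.indicator (fun _ => (volume E)⁻¹) t * v t := by
            refine setLIntegral_mono' hE fun t ht => ?_
            rw [indicator_of_mem ht]
            gcongr
            exact (show X < v t from ht.1).le
        _ ≤ _ := lintegral_mono_set inter_subset_right
  · have h1r : 0 < 1 - r := by linarith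
    rw [Vr_of_lt_one hr] at hX
    let φ : ℝ → ℝ≥0∞ := fun t => v t ^ (1 / (1 - r))
    have hφ : Measurable φ := hv.pow_const _
    let E : ℕ → Set ℝ := fun n => {t | v t ≤ n} ∩ Ioo x y
    have hE : ∀ n, MeasurableSet (E n) := fun n =>
      (measurableSet_le hv measurable_const).inter measurableSet_Ioo
    have hEm : Monotone E := fun m n hmn t ht =>
      ⟨le_trans (show v t ≤ m from ht.1) (by exact_mod_cast hmn), ht.2⟩
    have hEU : ⋃ n, E n = Ioo x y := by
      ext t
      simp only [mem_iUnion]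
      refine ⟨fun ⟨n, h⟩ => h.2, fun h => ?_⟩
      obtain ⟨n, hn⟩ := ENNReal.exists_nat_gt (hfin t h)
      exact ⟨n, hn.le, h⟩
    have hsup : ∫⁻ t in Ioo x y, φ t = ⨆ n, ∫⁻ t in E n, φ t := by
      rw [← hEU]
      exact setLIntegral_iUnion_of_directed φ hEm.directed_le
    have hγ : 0 < (1 - r) / r := div_pos h1r hr0
    have hX' : X ^ (r / (1 - r)) < ⨆ n, ∫⁻ t in E n, φ t := by
      rw [← hsup]
      have := ENNReal.rpow_lt_rpow hX (inv_pos.2 hγ)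
      rwa [← ENNReal.rpow_mul, mul_inv_cancel₀ hγ.ne', ENNReal.rpow_one, inv_div] at this
    obtain ⟨n, hn⟩ := lt_iSup_iff.1 hX'
    set I := ∫⁻ t in E n, φ t with hI
    have hI0 : I ≠ 0 := (bot_le.trans_lt hn).ne'
    have hIt : I ≠ ∞ := by
      have : I ≤ ∫⁻ _ in E n, (n : ℝ≥0∞) ^ (1 / (1 - r)) :=
        setLIntegral_mono' (hE n) fun t ht =>
          ENNReal.rpow_le_rpow ht.1 (one_div_nonneg.2 h1r.le)
      refine ne_top_of_le_ne_top ?_ this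
      rw [setLIntegral_const]
      refine ENNReal.mul_ne_top (ENNReal.rpow_ne_top_of_nonneg (one_div_nonneg.2 h1r.le)
        (ENNReal.natCast_ne_top n)) ?_
      refine ((measure_mono (t := Ioo x y) inter_subset_right).trans_lt ?_).ne
      simp
    refine ⟨(E n).indicator fun t => φ t * I⁻¹, (hφ.mul_const _).indicator (hE n),
      fun t ht => indicator_of_notMem (fun h => ht h.2) _, ?_, ?_⟩
    · rw [lintegral_indicator (hE n), lintegral_mul_const _ hφ, ENNReal.mul_inv_cancel hI0 hIt]
    · calc X ^ r = (X ^ (r / (1 - r))) ^ (1 - r) := by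
            rw [← ENNReal.rpow_mul, div_mul_cancel₀ _ h1r.ne']
        _ ≤ I ^ (1 - r) := ENNReal.rpow_le_rpow hn.le h1r.le
        _ = ∫⁻ t in E n, φ t * I⁻¹ ^ r := by
            rw [lintegral_mul_const _ hφ, ← hI, ENNReal.inv_rpow, ENNReal.rpow_sub _ _ hI0 hIt,
              ENNReal.rpow_one, div_eq_mul_inv]
        _ ≤ ∫⁻ t in E n, (E n).indicator (fun t => φ t * I⁻¹) t ^ r * v t := by
            refine setLIntegral_mono' (hE n) fun t ht => ?_
            rw [indicator_of_mem ht, ENNReal.mul_rpow_of_nonneg _ _ hr0.le, mul_right_comm]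
            gcongr
            refine le_of_eq ?_
            rw [← ENNReal.rpow_mul]
            change v t ^ (1 / (1 - r)) = _
            nth_rewrite 3 [← ENNReal.rpow_one (v t)]
            rw [← ENNReal.rpow_add_of_nonneg _ _ (by positivity) zero_le_one]
            congr 1
            field_simp
            ring
        _ ≤ _ := lintegral_mono_set inter_subset_right

/-- A Hardy-type inequality for `s < 1`: if the increments of `N` are controlled by the measure `ρ`
and the nondecreasing function `Ψ`, then the integral of `N` against `u` is controlled by
the corresponding weighted integral of `Ψ`. -/
theorem lintegral_mul_le_of_increments {s : ℝ} (hs0 : 0 < s) (hs1 : s < 1) {u : ℝ → ℝ≥0∞} {α β : ℝ}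
    (hu : HasTails u α β) {N Ψ : ℝ → ℝ≥0∞} (ρ : Measure ℝ) (hN0 : N α = 0) (hN : Monotone N)
    (hΨ : Monotone Ψ)
    (hinc : ∀ x y, α ≤ x → x < y → y < β → N y ≤ N x + (ρ (Ico x y) * Ψ y) ^ s) :
    ∫⁻ t in Ioo α β, N t * u t ≤ 8 * ρ (Ico α β) ^ s *
      (∫⁻ t in Ioo α β, (∫⁻ x in Ioo t β, u x) ^ (s / (1 - s)) * u t * Ψ t ^ (s / (1 - s)))
        ^ (1 - s) := by
  obtain ⟨t, ht, hlev⟩ := hu.exists_partition (K := 2) le_rfl (by simp)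
  have h1s : 0 < 1 - s := by linarith
  have hl0 : 0 ≤ s / (1 - s) := by positivity
  set l := s / (1 - s) with hl
  have hl1 : (l + 1) * (1 - s) = 1 := by rw [hl]; field_simp; ring
  have hl2 : l * (1 - s) = s := by rw [hl]; field_simp
  set G : ℕ → ℝ≥0∞ := fun k => ∫⁻ x in Ioo (t k) β, u x with hG
  have hG4 : ∀ k, G k = 4 * G (k + 1 + 1) := fun k => by
    rw [hG]
    dsimp only
    rw [← hlev k, ← hlev (k + 1), ← mul_assoc]
    norm_num
  have h1 : ∫⁻ x in Ioo α β, N x * u x ≤ ∑' k, G k * N (t (k + 1)) := by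
    rw [← ht.tsum_lintegral]
    refine ENNReal.tsum_le_tsum fun k => ?_
    calc ∫⁻ x in Ioo (t k) (t (k + 1)), N x * u x
        ≤ ∫⁻ x in Ioo (t k) (t (k + 1)), N (t (k + 1)) * u x := by
          refine setLIntegral_mono' measurableSet_Ioo fun x hx => ?_
          gcongr
          exact hN hx.2.le
      _ = (∫⁻ x in Ioo (t k) (t (k + 1)), u x) * N (t (k + 1)) := by
          rw [lintegral_const_mul _ hu.meas, mul_comm]
      _ ≤ _ := by
          gcongr
          exact lintegral_mono_set (Ioo_subset_Ioo_right (ht.lt _).le)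
  have h2 : ∑' k, G k * N (t (k + 1)) ≤ 2 * 1 *
      ∑' k, G k * (ρ (Ico (t k) (t (k + 1))) * Ψ (t (k + 1))) ^ s := by
    refine tsum_mul_le_of_recursion (E := fun k => N (t k)) (fun k => ?_) ?_ fun k => ?_
    · rw [mul_one]
      exact (hlev k).le
    · rw [ht.zero, hN0]
    · rw [one_mul]
      exact hinc _ _ (ht.le k) (ht.lt_succ k) (ht.lt _)
  have h3 : ∀ k, G k * (ρ (Ico (t k) (t (k + 1))) * Ψ (t (k + 1))) ^ s =
      4 * (ρ (Ico (t k) (t (k + 1))) ^ s *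
        (G (k + 1 + 1) ^ (l + 1) * Ψ (t (k + 1)) ^ l) ^ (1 - s)) := by
    intro k
    rw [ENNReal.mul_rpow_of_nonneg _ _ hs0.le, ENNReal.mul_rpow_of_nonneg _ _ h1s.le,
      ← ENNReal.rpow_mul, ← ENNReal.rpow_mul, hl1, hl2, ENNReal.rpow_one, hG4 k]
    ring
  have h4 : ∀ k, G (k + 1 + 1) ^ (l + 1) * Ψ (t (k + 1)) ^ l ≤
      ∫⁻ x in Ioo (t (k + 1)) (t (k + 1 + 1)), (∫⁻ y in Ioo x β, u y) ^ l * u x * Ψ x ^ l := by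
    intro k
    calc G (k + 1 + 1) ^ (l + 1) * Ψ (t (k + 1)) ^ l
        = G (k + 1 + 1) ^ l * Ψ (t (k + 1)) ^ l * G (k + 1 + 1) := by
          rw [ENNReal.rpow_add_of_nonneg _ _ hl0 zero_le_one, ENNReal.rpow_one]
          ring
      _ ≤ G (k + 1 + 1) ^ l * Ψ (t (k + 1)) ^ l * ∫⁻ x in Ioo (t (k + 1)) (t (k + 1 + 1)), u x := by
          gcongr
          exact hu.lintegral_le_of_level (ht.le _) (ht.lt_succ _).le (ht.lt _).le le_rfl (hlev _)
      _ = ∫⁻ x in Ioo (t (k + 1)) (t (k + 1 + 1)), G (k + 1 + 1) ^ l * Ψ (t (k + 1)) ^ l * u x :=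
          (lintegral_const_mul _ hu.meas).symm
      _ ≤ _ := by
          refine setLIntegral_mono' measurableSet_Ioo fun x hx => ?_
          rw [mul_right_comm]
          gcongr
          · exact lintegral_mono_set (Ioo_subset_Ioo_left hx.2.le)
          · exact hΨ hx.1.le
  calc ∫⁻ x in Ioo α β, N x * u x
      ≤ 2 * 1 * ∑' k, 4 * (ρ (Ico (t k) (t (k + 1))) ^ s *
        (G (k + 1 + 1) ^ (l + 1) * Ψ (t (k + 1)) ^ l) ^ (1 - s)) := by
        simp_rw [← h3]
        exact h1.trans h2
    _ = 8 * ∑' k, ρ (Ico (t k) (t (k + 1))) ^ s *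
        (G (k + 1 + 1) ^ (l + 1) * Ψ (t (k + 1)) ^ l) ^ (1 - s) := by
        rw [ENNReal.tsum_mul_left, ← mul_assoc]
        norm_num
    _ ≤ 8 * ((∑' k, ρ (Ico (t k) (t (k + 1)))) ^ s *
        (∑' k, G (k + 1 + 1) ^ (l + 1) * Ψ (t (k + 1)) ^ l) ^ (1 - s)) := by
        gcongr
        exact tsum_rpow_mul_rpow_le _ _ hs0.le hs1.le
    _ ≤ _ := by
        rw [ht.tsum_measure, mul_assoc]
        gcongr
        exact (ENNReal.tsum_le_tsum h4).trans (ht.tsum_lintegral_succ_le _)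

theorem monotone_lintegral_Ioo (g : ℝ → ℝ≥0∞) (x : ℝ) : Monotone fun t => ∫⁻ s in Ioo x t, g s :=
  fun _ _ h => lintegral_mono_set (Ioo_subset_Ioo_right h)

/-- The case of exponent one on the right-hand side. -/
theorem lintegral_rpow_mul_le_local {q r : ℝ} (hq0 : 0 < q) (hq1 : q < 1) (hqr : q ≤ r)
    (hr1 : r ≤ 1) {u v f : ℝ → ℝ≥0∞} {α β : ℝ} (hu : HasTails u α β) (hv : Measurable v)
    (hf : Measurable f) :
    ∫⁻ t in Ioo α β, (∫⁻ s in Ioo α t, f s ^ r * v s) ^ (q / r) * u t ≤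
      8 * (∫⁻ t in Ioo α β, f t) ^ q *
      (∫⁻ t in Ioo α β, (∫⁻ x in Ioo t β, u x) ^ (q / (1 - q)) * u t *
        Vr r v α t ^ (q / (1 - q))) ^ (1 - q) := by
  have hr0 : 0 < r := hq0.trans_le hqr
  have hqr0 : 0 < q / r := div_pos hq0 hr0
  have hρ : ∀ x y, (volume.withDensity f) (Ico x y) = ∫⁻ s in Ioo x y, f s := fun x y => by
    rw [withDensity_apply _ measurableSet_Ico, lintegral_Ico_eq_Ioo]
  rw [← hρ]
  refine lintegral_mul_le_of_increments hq0 hq1 hu (volume.withDensity f) ?_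
    (fun x y h => ENNReal.rpow_le_rpow (monotone_lintegral_Ioo _ α h) hqr0.le)
    (fun x y h => Vr_mono hr0 hr1 v le_rfl h) fun x y hx hxy _ => ?_
  · simp [hqr0]
  · rw [lintegral_Ioo_add_Ioo _ hx hxy.le]
    refine (ENNReal.rpow_add_le_add_rpow _ _ hqr0.le ((div_le_one hr0).2 hqr)).trans ?_
    gcongr
    calc (∫⁻ s in Ioo x y, f s ^ r * v s) ^ (q / r)
        ≤ (((∫⁻ s in Ioo x y, f s) * Vr r v x y) ^ r) ^ (q / r) := by
          gcongr
          exact lintegral_rpow_mul_le_Vr hr0 hr1 hf hv x y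
      _ = ((∫⁻ s in Ioo x y, f s) * Vr r v x y) ^ q := by
          rw [← ENNReal.rpow_mul, mul_div_cancel₀ _ hr0.ne']
      _ ≤ _ := by
          rw [hρ]
          gcongr
          exact Vr_mono hr0 hr1 v hx le_rfl

/-- The supremum over `t ∈ [α, y)` of `W(t)⁻¹ V_r(t, y)^p`. -/
def supVr (p r : ℝ) (v W : ℝ → ℝ≥0∞) (α y : ℝ) : ℝ≥0∞ :=
  ⨆ t ∈ Ico α y, (W t)⁻¹ * Vr r v t y ^ p

theorem le_supVr {p r : ℝ} {v W : ℝ → ℝ≥0∞} {α y t : ℝ} (ht : t ∈ Ico α y) :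
    (W t)⁻¹ * Vr r v t y ^ p ≤ supVr p r v W α y :=
  le_iSup₂ (f := fun t (_ : t ∈ Ico α y) => (W t)⁻¹ * Vr r v t y ^ p) t ht

theorem supVr_mono {p r : ℝ} (hp : 0 ≤ p) (hr0 : 0 < r) (hr1 : r ≤ 1) {v W : ℝ → ℝ≥0∞}
    {α α' y y' : ℝ} (hα : α' ≤ α) (hy : y ≤ y') :
    supVr p r v W α y ≤ supVr p r v W α' y' := by
  refine iSup₂_le fun t ht => le_trans ?_
    (le_supVr (t := t) ⟨hα.trans ht.1, ht.2.trans_le hy⟩)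
  gcongr
  exact Vr_mono hr0 hr1 v le_rfl hy

theorem inv_mul_rpow_rpow (x y : ℝ≥0∞) (p : ℝ) {l : ℝ} (hl : 0 ≤ l) :
    (x⁻¹ * y ^ p) ^ l = x ^ (-l) * y ^ (p * l) := by
  rw [ENNReal.mul_rpow_of_nonneg _ _ hl, ENNReal.inv_rpow, ENNReal.rpow_neg, ENNReal.rpow_mul]

theorem supVr_rpow_le {p r l : ℝ} (hl : 0 < l) {v W : ℝ → ℝ≥0∞} {α y : ℝ} {X : ℝ≥0∞}
    (h : ∀ t ∈ Ico α y, W t ^ (-l) * Vr r v t y ^ (p * l) ≤ X) :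
    supVr p r v W α y ^ l ≤ X := by
  rw [← ENNReal.le_rpow_inv_iff hl]
  refine iSup₂_le fun t ht => ?_
  rw [ENNReal.le_rpow_inv_iff hl, inv_mul_rpow_rpow _ _ _ hl.le]
  exact h t ht

theorem HasTails.exists_lt_le_two_mul {g : ℝ → ℝ≥0∞} {α β t : ℝ} (hg : HasTails g α β)
    (ht : t ∈ Ioo α β) :
    ∃ s ∈ Ico α t, ∫⁻ x in Ioo s β, g x ≤ 2 * ∫⁻ x in Ioo t β, g x := by
  rcases le_total (∫⁻ x in Ioo α β, g x) (2 * ∫⁻ x in Ioo t β, g x) with h | h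
  · exact ⟨α, ⟨le_rfl, ht.1⟩, h⟩
  · obtain ⟨s, hs, hsc⟩ := hg.exists_eq h
    refine ⟨s, ⟨hs.1, ?_⟩, hsc.le⟩
    by_contra! hcon
    have h1 : ∫⁻ x in Ioo s β, g x ≤ ∫⁻ x in Ioo t β, g x :=
      lintegral_mono_set (Ioo_subset_Ioo_left hcon)
    have h0 := hg.pos (x := t) ⟨ht.1.le, ht.2⟩
    have hfin := hg.lintegral_ne_top ht.1.le _ le_rfl
    rw [hsc, two_mul] at h1
    exact absurd h1 (not_le.2 (ENNReal.lt_add_right hfin h0.ne'))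

theorem le_essSup_of_tails {r l m : ℝ} (hl : 0 ≤ l) (hm : 0 ≤ m) (hr0 : 0 < r) (hr1 : r ≤ 1)
    {v w : ℝ → ℝ≥0∞} {a b t x : ℝ} (hw : ∀ α ∈ Ioo a b, HasTails w α b) (ht : t ∈ Ioo a x)
    (hx : x ≤ b) :
    (∫⁻ s in Ioo t b, w s) ^ (-l) * Vr r v t x ^ m ≤
      2 ^ l * essSup (fun t => (∫⁻ s in Ioo t b, w s) ^ (-l) * Vr r v t x ^ m)
        (volume.restrict (Ioo a x)) := by
  obtain ⟨a', ha'⟩ := exists_between ht.1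
  have ha'b : a' ∈ Ioo a b := ⟨ha'.1, ha'.2.trans (ht.2.trans_le hx)⟩
  obtain ⟨s₀, hs₀, hs₀W⟩ := (hw a' ha'b).exists_lt_le_two_mul (t := t) ⟨ha'.2, ht.2.trans_le hx⟩
  have hae := (ae_restrict_iff' measurableSet_Ioo).1 (ENNReal.ae_le_essSup
    (μ := volume.restrict (Ioo a x)) fun t => (∫⁻ s in Ioo t b, w s) ^ (-l) * Vr r v t x ^ m)
  obtain ⟨s, hs, hsE⟩ : ∃ s ∈ Ioo s₀ t, (∫⁻ y in Ioo s b, w y) ^ (-l) * Vr r v s x ^ m ≤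
      essSup (fun t => (∫⁻ s in Ioo t b, w s) ^ (-l) * Vr r v t x ^ m)
        (volume.restrict (Ioo a x)) := by
    by_contra! hcon
    have h0 : volume (Ioo s₀ t) = 0 := by
      refine measure_mono_null (fun s hs => ?_) (ae_iff.1 hae)
      simp only [mem_ofPred_eq, Classical.not_imp, not_le]
      exact ⟨⟨ha'.1.trans_le (hs₀.1.trans hs.1.le), hs.2.trans ht.2⟩, hcon s hs⟩
    simp only [Real.volume_Ioo, ENNReal.ofReal_eq_zero, sub_nonpos] at h0
    exact absurd hs₀.2 (not_lt.2 h0)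
  refine le_trans ?_ (mul_le_mul_right hsE _)
  have hW : ∫⁻ y in Ioo s b, w y ≤ 2 * ∫⁻ y in Ioo t b, w y :=
    (lintegral_mono_set (Ioo_subset_Ioo_left hs.1.le)).trans hs₀W
  have hV : Vr r v t x ≤ Vr r v s x := Vr_mono hr0 hr1 v hs.2.le le_rfl
  rw [← mul_assoc]
  gcongr
  rw [ENNReal.rpow_neg, ENNReal.rpow_neg, ← div_eq_mul_inv]
  calc ((∫⁻ y in Ioo t b, w y) ^ l)⁻¹
      = 2 ^ l * ((2 : ℝ≥0∞) ^ l * (∫⁻ y in Ioo t b, w y) ^ l)⁻¹ := by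
        have h2 : (2 : ℝ≥0∞) ^ l ≠ ∞ := ENNReal.rpow_ne_top_of_nonneg hl (by simp)
        have h2' : (2 : ℝ≥0∞) ^ l ≠ 0 := by simp [ENNReal.rpow_eq_zero_iff, hl.not_gt]
        rw [ENNReal.mul_inv (Or.inl h2') (Or.inl h2), ← mul_assoc,
          ENNReal.mul_inv_cancel h2' h2, one_mul]
    _ ≤ 2 ^ l * ((∫⁻ y in Ioo s b, w y) ^ l)⁻¹ := by
        rw [← ENNReal.mul_rpow_of_nonneg _ _ hl]
        gcongr
    _ = _ := (div_eq_mul_inv _ _).symm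

theorem tsum_tail_mul_rpow_le {p : ℝ} (hp0 : 0 < p) {w f : ℝ → ℝ≥0∞} {a α b : ℝ} (ha : a < α)
    (hw : HasTails w α b) {t : ℕ → ℝ} (ht : IsPartition t α b)
    (hlev : ∀ k, 2 * ∫⁻ x in Ioo (t (k + 1)) b, w x = ∫⁻ x in Ioo (t k) b, w x) :
    ∑' k, (∫⁻ x in Ioo (t k) b, w x) * (∫⁻ x in Ioo (t k) (t (k + 1)), f x) ^ p ≤
      4 * ∫⁻ t in Ioo a b, (∫⁻ s in Ioo a t, f s) ^ p * w t := by
  calc _ ≤ ∑' k, 4 * ∫⁻ x in Ioo (t (k + 1)) (t (k + 1 + 1)),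
          (∫⁻ s in Ioo a x, f s) ^ p * w x := by
        refine ENNReal.tsum_le_tsum fun k => ?_
        rw [← hlev k, ← hlev (k + 1), ← mul_assoc, mul_assoc]
        norm_num
        gcongr
        calc (∫⁻ x in Ioo (t (k + 1 + 1)) b, w x) * (∫⁻ x in Ioo (t k) (t (k + 1)), f x) ^ p
            ≤ (∫⁻ x in Ioo (t (k + 1)) (t (k + 1 + 1)), w x) *
                (∫⁻ x in Ioo (t k) (t (k + 1)), f x) ^ p := by
              gcongr ?_ * _
              exact hw.lintegral_le_of_level (ht.le _) (ht.lt_succ _).le (ht.lt _).le le_rfl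
                (hlev _)
          _ = ∫⁻ x in Ioo (t (k + 1)) (t (k + 1 + 1)),
                (∫⁻ x in Ioo (t k) (t (k + 1)), f x) ^ p * w x := by
              rw [lintegral_const_mul _ hw.meas, mul_comm]
          _ ≤ _ := by
              refine setLIntegral_mono' measurableSet_Ioo fun x hx => ?_
              gcongr
              exacts [(ha.trans_le (ht.le k)).le, hx.1.le]
    _ ≤ _ := by
        rw [ENNReal.tsum_mul_left]
        gcongr
        exact (ht.tsum_lintegral_succ_le _).trans
          (lintegral_mono_set (Ioo_subset_Ioo_left ha.le))

theorem lintegral_Ioo_partition_eq_sum {t : ℕ → ℝ} {α β : ℝ} (ht : IsPartition t α β)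
    (g : ℝ → ℝ≥0∞) (k : ℕ) :
    ∫⁻ x in Ioo α (t k), g x = ∑ j ∈ Finset.range k, ∫⁻ x in Ioo (t j) (t (j + 1)), g x := by
  induction k with
  | zero => simp [ht.zero]
  | succ k ih =>
    rw [Finset.sum_range_succ, ← ih, lintegral_Ioo_add_Ioo g (ht.le k) (ht.lt_succ k).le]

/-- The contribution of the mass of `f` carried by earlier blocks. -/
theorem lintegral_sum_blocks_le {p q r : ℝ} (hq0 : 0 < q) (hqp : q < p) (hpr : p ≤ r)
    (hr1 : r ≤ 1) {u v f W : ℝ → ℝ≥0∞} {α b : ℝ} (hu : HasTails u α b) (hv : Measurable v)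
    (hf : Measurable f) {t : ℕ → ℝ} (ht : IsPartition t α b) (hW0 : ∀ k, W (t k) ≠ 0)
    (hWt : ∀ k, W (t k) ≠ ∞) :
    ∑' k, ∫⁻ x in Ioo (t k) (t (k + 1)),
        (∫⁻ s in Ioo α (t k), f s ^ r * v s) ^ (q / r) * u x ≤
      8 * (∑' k, W (t k) * (∫⁻ x in Ioo (t k) (t (k + 1)), f x) ^ p) ^ (q / p) *
      (∫⁻ x in Ioo α b, (∫⁻ s in Ioo x b, u s) ^ (q / (p - q)) * u x *
        supVr p r v W α x ^ (q / (p - q))) ^ (1 - q / p) := by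
  have hp0 : 0 < p := hq0.trans hqp
  have hr0 : 0 < r := hp0.trans_le hpr
  have hs0 : 0 < q / p := div_pos hq0 hp0
  have hs1 : q / p < 1 := (div_lt_one hp0).2 hqp
  have hqr0 : 0 < q / r := div_pos hq0 hr0
  have hqr1 : q / r ≤ 1 := (div_le_one hr0).2 (hqp.le.trans hpr)
  have hl : q / p / (1 - q / p) = q / (p - q) := by
    have : p - q ≠ 0 := by linarith
    field_simp
  set h : ℕ → ℝ≥0∞ := fun j => ∫⁻ x in Ioo (t j) (t (j + 1)), f x ^ r * v x with hh
  set A : ℕ → ℝ≥0∞ := fun k => W (t k) * (∫⁻ x in Ioo (t k) (t (k + 1)), f x) ^ p with hA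
  let ρ : Measure ℝ := Measure.sum fun j => A j • Measure.dirac (t (j + 1))
  have hρ : ∀ S : Set ℝ, MeasurableSet S → ρ S = ∑' j, A j * S.indicator 1 (t (j + 1)) := by
    intro S hS
    simp only [ρ, Measure.sum_apply _ hS, Measure.smul_apply, Measure.dirac_apply' _ hS,
      smul_eq_mul]
  have hρ1 : ρ (Ico α b) ≤ ∑' k, A k := by
    rw [hρ _ measurableSet_Ico]
    refine ENNReal.tsum_le_tsum fun j => mul_le_of_le_one_right' ?_
    exact indicator_le_self' (fun _ _ => zero_le_one) _
  let N : ℝ → ℝ≥0∞ := fun y => (∑' j, (Iio y).indicator (fun _ => h j) (t (j + 1))) ^ (q / r)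
  have hN : Monotone N := by
    intro x y hxy
    refine ENNReal.rpow_le_rpow (ENNReal.tsum_le_tsum fun j => ?_) hqr0.le
    exact indicator_le_indicator_of_subset (Iio_subset_Iio hxy) (fun _ => zero_le) _
  have key := lintegral_mul_le_of_increments hs0 hs1 hu (N := N) (Ψ := supVr p r v W α) ρ ?_ hN
    (fun x y hxy => supVr_mono hp0.le hr0 hr1 le_rfl hxy) ?_
  · rw [hl] at key
    refine le_trans ?_ (key.trans ?_)
    · rw [← ht.tsum_lintegral]
      refine ENNReal.tsum_le_tsum fun k => ?_
      refine setLIntegral_mono' measurableSet_Ioo fun x hx => ?_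
      gcongr ?_ * _
      refine ENNReal.rpow_le_rpow ?_ hqr0.le
      rw [lintegral_Ioo_partition_eq_sum ht]
      refine le_trans (Finset.sum_le_sum fun j hj => ?_) (ENNReal.sum_le_tsum (Finset.range k))
      rw [indicator_of_mem]
      have hjk : t (j + 1) ≤ t k := ht.strictMono.monotone (Finset.mem_range.1 hj)
      exact hjk.trans_lt hx.1
    · gcongr
  · simp only [N]
    rw [ENNReal.rpow_eq_zero_iff]
    refine Or.inl ⟨?_, hqr0⟩
    refine ENNReal.tsum_eq_zero.2 fun j => indicator_of_notMem ?_ _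
    exact not_lt.2 (ht.le _)
  · intro x y hx hxy hyb
    have hsplit : ∑' j, (Iio y).indicator (fun _ => h j) (t (j + 1)) =
        ∑' j, (Iio x).indicator (fun _ => h j) (t (j + 1)) +
        ∑' j, (Ico x y).indicator (fun _ => h j) (t (j + 1)) := by
      rw [← ENNReal.tsum_add]
      refine tsum_congr fun j => ?_
      rw [← Iio_union_Ico_eq_Iio hxy.le, indicator_union_of_disjoint]
      exact disjoint_left.2 fun z hz hz' => absurd hz (not_lt.2 hz'.1)
    have hblock : ∀ j, (Ico x y).indicator (fun _ => h j) (t (j + 1)) ^ (p / r) ≤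
        A j * (Ico x y).indicator 1 (t (j + 1)) * supVr p r v W α y := by
      intro j
      by_cases hj : t (j + 1) ∈ Ico x y
      · rw [indicator_of_mem hj, indicator_of_mem hj, Pi.one_apply, mul_one]
        calc h j ^ (p / r)
            ≤ (((∫⁻ x in Ioo (t j) (t (j + 1)), f x) * Vr r v (t j) (t (j + 1))) ^ r)
                ^ (p / r) := by
              gcongr
              exact lintegral_rpow_mul_le_Vr hr0 hr1 hf hv _ _
          _ = (∫⁻ x in Ioo (t j) (t (j + 1)), f x) ^ p * Vr r v (t j) (t (j + 1)) ^ p := by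
              rw [← ENNReal.rpow_mul, mul_div_cancel₀ _ hr0.ne',
                ENNReal.mul_rpow_of_nonneg _ _ hp0.le]
          _ = A j * ((W (t j))⁻¹ * Vr r v (t j) (t (j + 1)) ^ p) := by
              rw [hA]
              dsimp only
              rw [mul_comm (W (t j)), mul_assoc, ← mul_assoc (W (t j)),
                ENNReal.mul_inv_cancel (hW0 j) (hWt j), one_mul]
          _ ≤ A j * ((W (t j))⁻¹ * Vr r v (t j) y ^ p) := by
              gcongr
              exact Vr_mono hr0 hr1 v le_rfl hj.2.le
          _ ≤ _ := by
              gcongr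
              exact le_supVr ⟨ht.le j, (ht.lt_succ j).trans hj.2⟩
      · rw [indicator_of_notMem hj, indicator_of_notMem hj,
          ENNReal.zero_rpow_of_pos (div_pos hp0 hr0)]
        exact zero_le
    simp only [N]
    rw [hsplit]
    refine (ENNReal.rpow_add_le_add_rpow _ _ hqr0.le hqr1).trans ?_
    gcongr
    calc (∑' j, (Ico x y).indicator (fun _ => h j) (t (j + 1))) ^ (q / r)
        = ((∑' j, (Ico x y).indicator (fun _ => h j) (t (j + 1))) ^ (p / r)) ^ (q / p) := by
          rw [← ENNReal.rpow_mul]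
          congr 1
          field_simp
      _ ≤ (∑' j, (Ico x y).indicator (fun _ => h j) (t (j + 1)) ^ (p / r)) ^ (q / p) := by
          gcongr
          exact rpow_tsum_le_tsum_rpow _ (div_pos hp0 hr0) ((div_le_one hr0).2 hpr)
      _ ≤ _ := by
          rw [hρ _ measurableSet_Ico, ← ENNReal.tsum_mul_right]
          gcongr with j
          exact hblock j

/-- The local integral appearing in the definition of `C₅`. -/
def localInt (q r : ℝ) (u v : ℝ → ℝ≥0∞) (y x : ℝ) : ℝ≥0∞ :=
  ∫⁻ t in Ioo y x, (∫⁻ s in Ioo t x, u s) ^ (q / (1 - q)) * u t * Vr r v y t ^ (q / (1 - q))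

theorem localInt_mono {q r : ℝ} (hq0 : 0 < q) (hq1 : q < 1) (hr0 : 0 < r) (hr1 : r ≤ 1)
    (u v : ℝ → ℝ≥0∞) {y x y' x' : ℝ} (hy : y' ≤ y) (hx : x ≤ x') :
    localInt q r u v y x ≤ localInt q r u v y' x' := by
  have hl : 0 ≤ q / (1 - q) := div_nonneg hq0.le (by linarith)
  refine (lintegral_mono_set (Ioo_subset_Ioo hy hx)).trans' (lintegral_mono fun t => ?_)
  gcongr
  exact Vr_mono hr0 hr1 v hy le_rfl

/-- The contribution of the mass of `f` carried by the current block. -/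
theorem tsum_lintegral_block_le {p q r : ℝ} (hq0 : 0 < q) (hqp : q < p) (hpr : p ≤ r)
    (hr1 : r ≤ 1) {u v f : ℝ → ℝ≥0∞} {α b : ℝ} (hu : ∀ t ∈ Ioo α b, 0 < u t)
    (hu' : HasTails u α b) (hv : Measurable v)
    (hf : Measurable f) {t : ℕ → ℝ} (ht : IsPartition t α b) {W : ℕ → ℝ≥0∞} (hW0 : ∀ k, W k ≠ 0)
    (hWt : ∀ k, W k ≠ ∞) :
    ∑' k, ∫⁻ x in Ioo (t k) (t (k + 1)),
        (∫⁻ s in Ioo (t k) x, f s ^ r * v s) ^ (q / r) * u x ≤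
      8 * (∑' k, W k * (∫⁻ x in Ioo (t k) (t (k + 1)), f x) ^ p) ^ (q / p) *
      (∑' k, W k ^ (-(q / (p - q))) *
        localInt q r u v (t k) (t (k + 1)) ^ (p * (1 - q) / (p - q))) ^ (1 - q / p) := by
  have hp0 : 0 < p := hq0.trans hqp
  have hpq : 0 < p - q := by linarith
  have hq1 : q < 1 := hqp.trans_le (hpr.trans hr1)
  have hs0 : 0 < q / p := div_pos hq0 hp0
  have hs1 : q / p < 1 := (div_lt_one hp0).2 hqp
  have hblock : ∀ k, ∫⁻ x in Ioo (t k) (t (k + 1)),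
        (∫⁻ s in Ioo (t k) x, f s ^ r * v s) ^ (q / r) * u x ≤
      8 * ((W k * (∫⁻ x in Ioo (t k) (t (k + 1)), f x) ^ p) ^ (q / p) *
        (W k ^ (-(q / (p - q))) *
          localInt q r u v (t k) (t (k + 1)) ^ (p * (1 - q) / (p - q))) ^ (1 - q / p)) := by
    intro k
    have htails : HasTails u (t k) (t (k + 1)) :=
      hasTails_of_pos (ht.lt_succ k) hu'.meas
        (fun x hx => hu x ⟨(ht.le k).trans_lt hx.1, hx.2.trans (ht.lt _)⟩)
        (hu'.lintegral_ne_top (ht.le k) _ (ht.lt _).le).lt_top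
    refine (lintegral_rpow_mul_le_local hq0 hq1 (hqp.le.trans hpr) hr1 htails hv hf).trans ?_
    rw [mul_assoc]
    refine mul_le_mul_right ?_ _
    change _ * localInt q r u v (t k) (t (k + 1)) ^ (1 - q) ≤ _
    rw [ENNReal.mul_rpow_of_nonneg _ _ hs0.le, ENNReal.mul_rpow_of_nonneg _ _ (by linarith),
      ← ENNReal.rpow_mul, ← ENNReal.rpow_mul, ← ENNReal.rpow_mul]
    have e1 : p * (q / p) = q := by field_simp
    have e2 : -(q / (p - q)) * (1 - q / p) = -(q / p) := by field_simp
    have e3 : p * (1 - q) / (p - q) * (1 - q / p) = 1 - q := by field_simp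
    rw [e1, e2, e3, mul_mul_mul_comm, ← ENNReal.rpow_add _ _ (hW0 k) (hWt k), add_neg_cancel,
      ENNReal.rpow_zero, one_mul]
  refine (ENNReal.tsum_le_tsum hblock).trans ?_
  rw [ENNReal.tsum_mul_left, mul_assoc]
  gcongr
  exact tsum_rpow_mul_rpow_le _ _ hs0.le hs1.le

theorem tsum_localInt_le {p q r : ℝ} (hq0 : 0 < q) (hqp : q < p) (hpr : p ≤ r) (hr1 : r ≤ 1)
    {u v w : ℝ → ℝ≥0∞} {a α b : ℝ} (ha : a < α) (hw : HasTails w α b)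
    {t : ℕ → ℝ} (ht : IsPartition t α b)
    (hlev : ∀ k, 2 * ∫⁻ x in Ioo (t (k + 1)) b, w x = ∫⁻ x in Ioo (t k) b, w x) :
    ∑' k, (∫⁻ x in Ioo (t k) b, w x) ^ (-(q / (p - q))) *
        localInt q r u v (t k) (t (k + 1)) ^ (p * (1 - q) / (p - q)) ≤
      4 * ∫⁻ x in Ioo a b, w x * ⨆ y ∈ Ioo a x, (∫⁻ s in Ioo y b, w s) ^ (-(p / (p - q))) *
        localInt q r u v y x ^ (p * (1 - q) / (p - q)) := by
  have hp0 : 0 < p := hq0.trans hqp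
  have hpq : 0 < p - q := by linarith
  have hr0 : 0 < r := hp0.trans_le hpr
  have hq1 : q < 1 := hqp.trans_le (hpr.trans hr1)
  have hm : 0 ≤ p * (1 - q) / (p - q) := by
    have : 0 < 1 - q := by linarith
    positivity
  have e1 : -(q / (p - q)) = 1 + -(p / (p - q)) := by field_simp; ring
  have hW0 : ∀ k, (∫⁻ x in Ioo (t k) b, w x) ≠ 0 := fun k => (hw.pos (ht.mem k)).ne'
  have hWt : ∀ k, (∫⁻ x in Ioo (t k) b, w x) ≠ ∞ := fun k =>
    hw.lintegral_ne_top (ht.le k) _ le_rfl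
  calc _ ≤ ∑' k, 4 * ∫⁻ x in Ioo (t (k + 1)) (t (k + 1 + 1)), w x * ⨆ y ∈ Ioo a x,
          (∫⁻ s in Ioo y b, w s) ^ (-(p / (p - q))) *
          localInt q r u v y x ^ (p * (1 - q) / (p - q)) := by
        refine ENNReal.tsum_le_tsum fun k => ?_
        rw [e1, ENNReal.rpow_add _ _ (hW0 k) (hWt k), ENNReal.rpow_one, mul_assoc]
        set X := (∫⁻ x in Ioo (t k) b, w x) ^ (-(p / (p - q))) *
          localInt q r u v (t k) (t (k + 1)) ^ (p * (1 - q) / (p - q)) with hX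
        have h4 : (∫⁻ x in Ioo (t k) b, w x) * X =
            4 * ((∫⁻ x in Ioo (t (k + 1 + 1)) b, w x) * X) := by
          rw [← hlev k, ← hlev (k + 1)]
          ring
        rw [h4]
        gcongr
        calc (∫⁻ x in Ioo (t (k + 1 + 1)) b, w x) * X
            ≤ (∫⁻ x in Ioo (t (k + 1)) (t (k + 1 + 1)), w x) * X := by
              gcongr ?_ * _
              exact hw.lintegral_le_of_level (ht.le _) (ht.lt_succ _).le (ht.lt _).le le_rfl
                (hlev _)
          _ = ∫⁻ x in Ioo (t (k + 1)) (t (k + 1 + 1)), w x * X := by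
              rw [lintegral_mul_const _ hw.meas]
          _ ≤ _ := by
              refine setLIntegral_mono' measurableSet_Ioo fun x hx => ?_
              gcongr
              have hmem : t k ∈ Ioo a x := ⟨ha.trans_le (ht.le k), (ht.lt_succ k).trans hx.1⟩
              refine le_trans ?_ (le_iSup₂ (f := fun y (_ : y ∈ Ioo a x) =>
                (∫⁻ s in Ioo y b, w s) ^ (-(p / (p - q))) *
                localInt q r u v y x ^ (p * (1 - q) / (p - q))) (t k) hmem)
              rw [hX]
              gcongr
              exact localInt_mono hq0 hq1 hr0 hr1 u v le_rfl hx.1.le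
    _ ≤ _ := by
        rw [ENNReal.tsum_mul_left]
        gcongr
        exact (ht.tsum_lintegral_succ_le _).trans
          (lintegral_mono_set (Ioo_subset_Ioo_left ha.le))

/-- The integral whose power is `C₄`. -/
def int₄ (a b r p q : ℝ) (u v w : ℝ → ℝ≥0∞) : ℝ≥0∞ :=
  ∫⁻ x in Ioo a b, (∫⁻ s in Ioo x b, u s) ^ (q / (p - q)) * u x *
      essSup (fun t => (∫⁻ s in Ioo t b, w s) ^ (-(q / (p - q))) *
          Vr r v t x ^ (p * q / (p - q)))
        (volume.restrict (Ioo a x))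

/-- The integral whose power is `C₅`. -/
def int₅ (a b r p q : ℝ) (u v w : ℝ → ℝ≥0∞) : ℝ≥0∞ :=
  ∫⁻ x in Ioo a b, w x *
      ⨆ y ∈ Ioo a x, (∫⁻ s in Ioo y b, w s) ^ (-(p / (p - q))) *
        localInt q r u v y x ^ (p * (1 - q) / (p - q))

theorem lintegral_supVr_le_int₄ {p q r : ℝ} (hq0 : 0 < q) (hqp : q < p) (hpr : p ≤ r) (hr1 : r ≤ 1)
    {u v w : ℝ → ℝ≥0∞} {a α b : ℝ} (ha : a < α) (hw : ∀ α ∈ Ioo a b, HasTails w α b) :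
    ∫⁻ x in Ioo α b, (∫⁻ s in Ioo x b, u s) ^ (q / (p - q)) * u x *
        supVr p r v (fun t => ∫⁻ s in Ioo t b, w s) α x ^ (q / (p - q)) ≤
      2 ^ (q / (p - q)) * int₄ a b r p q u v w := by
  have hp0 : 0 < p := hq0.trans hqp
  have hpq : 0 < p - q := by linarith
  have hr0 : 0 < r := hp0.trans_le hpr
  have hl : 0 < q / (p - q) := div_pos hq0 hpq
  rw [int₄, ← lintegral_const_mul' _ _ (ENNReal.rpow_ne_top_of_nonneg hl.le (by norm_num))]
  refine (setLIntegral_mono' measurableSet_Ioo fun x hx => ?_).trans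
    (lintegral_mono_set (Ioo_subset_Ioo_left ha.le))
  rw [mul_left_comm]
  gcongr
  refine supVr_rpow_le hl fun t ht => ?_
  have hm : 0 ≤ p * q / (p - q) := by positivity
  have := le_essSup_of_tails (r := r) (v := v) hl.le hm hr0 hr1 hw (x := x) (t := t)
    ⟨ha.trans_le ht.1, ht.2⟩ hx.2.le
  rwa [mul_div_assoc] at this ⊢

theorem lintegral_Ioo_le_of_int₄_int₅ {p q r : ℝ} (hq0 : 0 < q) (hqp : q < p) (hpr : p ≤ r)
    (hr1 : r ≤ 1) {u v w f : ℝ → ℝ≥0∞} {a α b : ℝ} (hα : α ∈ Ioo a b)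
    (hu : ∀ t ∈ Ioo α b, 0 < u t) (hu' : HasTails u α b) (hv : Measurable v)
    (hw : ∀ α ∈ Ioo a b, HasTails w α b) (hf : Measurable f) :
    ∫⁻ t in Ioo α b, (∫⁻ s in Ioo α t, f s ^ r * v s) ^ (q / r) * u t ≤
      8 * (4 * ∫⁻ t in Ioo a b, (∫⁻ s in Ioo a t, f s) ^ p * w t) ^ (q / p) *
      ((2 ^ (q / (p - q)) * int₄ a b r p q u v w) ^ (1 - q / p) +
        (4 * int₅ a b r p q u v w) ^ (1 - q / p)) := by
  have hp0 : 0 < p := hq0.trans hqp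
  have hpq : 0 < p - q := by linarith
  have hr0 : 0 < r := hp0.trans_le hpr
  have hqr0 : 0 < q / r := div_pos hq0 hr0
  have hqr1 : q / r ≤ 1 := (div_le_one hr0).2 (hqp.le.trans hpr)
  have hs0 : 0 < q / p := div_pos hq0 hp0
  have hs1 : 0 ≤ 1 - q / p := sub_nonneg.2 ((div_le_one hp0).2 hqp.le)
  have hwα := hw α hα
  obtain ⟨t, ht, hlev⟩ := hwα.exists_partition le_rfl (by norm_num)
  have hW0 : ∀ k, (∫⁻ x in Ioo (t k) b, w x) ≠ 0 := fun k => (hwα.pos (ht.mem k)).ne'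
  have hWt : ∀ k, (∫⁻ x in Ioo (t k) b, w x) ≠ ∞ := fun k =>
    hwα.lintegral_ne_top (ht.le k) _ le_rfl
  have hA := lintegral_sum_blocks_le hq0 hqp hpr hr1 hu' hv hf ht
    (W := fun x => ∫⁻ s in Ioo x b, w s) hW0 hWt
  have hB := tsum_lintegral_block_le hq0 hqp hpr hr1 hu hu' hv hf ht
    (W := fun k => ∫⁻ s in Ioo (t k) b, w s) hW0 hWt
  have hR := tsum_tail_mul_rpow_le hp0 (f := f) hα.1 hwα ht hlev
  have hsplit : ∫⁻ x in Ioo α b, (∫⁻ s in Ioo α x, f s ^ r * v s) ^ (q / r) * u x ≤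
      (∑' k, ∫⁻ x in Ioo (t k) (t (k + 1)),
        (∫⁻ s in Ioo α (t k), f s ^ r * v s) ^ (q / r) * u x) +
      ∑' k, ∫⁻ x in Ioo (t k) (t (k + 1)),
        (∫⁻ s in Ioo (t k) x, f s ^ r * v s) ^ (q / r) * u x := by
    rw [← ht.tsum_lintegral, ← ENNReal.tsum_add]
    refine ENNReal.tsum_le_tsum fun k => ?_
    rw [← lintegral_add_left (hu'.meas.const_mul _)]
    refine setLIntegral_mono' measurableSet_Ioo fun x hx => ?_
    rw [← add_mul, lintegral_Ioo_add_Ioo _ (ht.le k) hx.1.le]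
    gcongr
    exact ENNReal.rpow_add_le_add_rpow _ _ hqr0.le hqr1
  refine (hsplit.trans (add_le_add hA hB)).trans ?_
  rw [← mul_add]
  gcongr
  · exact lintegral_supVr_le_int₄ hq0 hqp hpr hr1 hα.1 hw
  · exact tsum_localInt_le hq0 hqp hpr hr1 hα.1 hwα ht hlev

/-- Monotone convergence as the left endpoint decreases. -/
theorem lintegral_Ioo_le_of_left_limit {a b : ℝ} (hab : a < b) {G : ℝ → ℝ≥0∞}
    {g : ℝ → ℝ → ℝ≥0∞} (hm : ∀ α ∈ Ioo a b, Measurable (g α))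
    (hanti : ∀ α ∈ Ioo a b, ∀ α' ∈ Ioo a b, α' ≤ α → ∀ t ∈ Ioo α b, g α t ≤ g α' t)
    (hG : ∀ t ∈ Ioo a b, G t ≤ ⨆ α ∈ Ioo a t, g α t) {X : ℝ≥0∞}
    (hX : ∀ α ∈ Ioo a b, ∫⁻ t in Ioo α b, g α t ≤ X) : ∫⁻ t in Ioo a b, G t ≤ X := by
  obtain ⟨s, hs, hsm, hst⟩ := exists_seq_strictAnti_tendsto' hab
  have h1 : ∫⁻ t in Ioo a b, G t ≤ ∫⁻ t, ⨆ n, (Ioo (s n) b).indicator (g (s n)) t := by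
    rw [← lintegral_indicator measurableSet_Ioo]
    refine lintegral_mono fun t => indicator_apply_le' (fun ht => ?_) fun _ => zero_le
    refine (hG t ht).trans (iSup₂_le fun α hα => ?_)
    obtain ⟨n, hn⟩ := (hst.eventually_lt_const hα.1).exists
    refine le_trans ?_ (le_iSup _ n)
    rw [indicator_of_mem (show t ∈ Ioo (s n) b from ⟨hn.trans hα.2, ht.2⟩)]
    exact hanti α ⟨hα.1, hα.2.trans ht.2⟩ _ (hsm n) hn.le t ⟨hα.2, ht.2⟩
  refine h1.trans ?_
  rw [lintegral_iSup (fun n => (hm _ (hsm n)).indicator measurableSet_Ioo)]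
  · refine iSup_le fun n => ?_
    rw [lintegral_indicator measurableSet_Ioo]
    exact hX _ (hsm n)
  · intro m n hmn t
    dsimp only
    by_cases ht : t ∈ Ioo (s m) b
    · rw [indicator_of_mem ht, indicator_of_mem
        (show t ∈ Ioo (s n) b from ⟨(hs.antitone hmn).trans_lt ht.1, ht.2⟩)]
      exact hanti _ (hsm m) _ (hsm n) (hs.antitone hmn) t ht
    · rw [indicator_of_notMem ht]
      exact zero_le

theorem lintegral_Ioo_eq_iSup_left {a t : ℝ} (g : ℝ → ℝ≥0∞) (hat : a < t) :
    ∫⁻ s in Ioo a t, g s = ⨆ α ∈ Ioo a t, ∫⁻ s in Ioo α t, g s := by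
  refine le_antisymm ?_ (iSup₂_le fun α hα => lintegral_mono_set (Ioo_subset_Ioo_left hα.1.le))
  obtain ⟨s, hs, hsm, hst⟩ := exists_seq_strictAnti_tendsto' hat
  have hU : Ioo a t = ⋃ n, Ioo (s n) t := by
    ext x
    simp only [mem_iUnion, mem_Ioo]
    constructor
    · rintro ⟨h1, h2⟩
      obtain ⟨n, hn⟩ := (hst.eventually_lt_const h1).exists
      exact ⟨n, hn, h2⟩
    · rintro ⟨n, h1, h2⟩
      exact ⟨(hsm n).1.trans h1, h2⟩
  rw [hU, setLIntegral_iUnion_of_directed g]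
  · exact iSup_le fun n => le_iSup₂_of_le (s n) ((by rw [← hU]; exact hsm n)) le_rfl
  · exact directed_of_isDirected_le fun m n h => Ioo_subset_Ioo_left (hs.antitone h)

theorem hasTails_of_int₄_lt_top {p q r : ℝ} (hq0 : 0 < q) (hqp : q < p) (hpr : p ≤ r)
    (hr1 : r ≤ 1) {u v w : ℝ → ℝ≥0∞} {a α b : ℝ} (hα : α ∈ Ioo a b) (hu : IsWeight a b u)
    (hv : IsWeight a b v) (hw : ∀ α ∈ Ioo a b, HasTails w α b)
    (h4 : int₄ a b r p q u v w < ∞) : HasTails u α b := by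
  have hp0 : 0 < p := hq0.trans hqp
  have hpq : 0 < p - q := by linarith
  have hr0 : 0 < r := hp0.trans_le hpr
  have hl : 0 < q / (p - q) := div_pos hq0 hpq
  refine hasTails_of_pos hα.2 hu.1 (fun t ht => (hu.2 t ⟨hα.1.trans ht.1, ht.2⟩).1) ?_
  by_contra hU
  rw [not_lt, top_le_iff] at hU
  refine h4.not_ge ?_
  rw [int₄]
  refine le_trans ?_ (lintegral_mono_set (Ioo_subset_Ioo_right hα.2.le))
  calc ∞ = ∫⁻ x in Ioo a α, ∞ := by simp [hα.1]
    _ ≤ _ := by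
      refine setLIntegral_mono' measurableSet_Ioo fun x hx => ?_
      have hxU : ∫⁻ s in Ioo x b, u s = ∞ :=
        top_le_iff.1 (hU.ge.trans (lintegral_mono_set (Ioo_subset_Ioo_left hx.2.le)))
      rw [hxU, ENNReal.top_rpow_of_pos hl, ENNReal.top_mul (hu.2 x ⟨hx.1, hx.2.trans hα.2⟩).1.ne',
        ENNReal.top_mul]
      obtain ⟨t, ht⟩ := exists_between hx.1
      have hxb := hx.2.trans hα.2
      have htb : t ∈ Ioo a b := ⟨ht.1, ht.2.trans hxb⟩
      have hle := le_essSup_of_tails (r := r) (v := v) (m := p * q / (p - q)) hl.le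
        (by positivity) hr0 hr1 hw ht hxb.le
      intro h0
      rw [h0, mul_zero, nonpos_iff_eq_zero, mul_eq_zero] at hle
      rcases hle with h | h
      · rw [ENNReal.rpow_eq_zero_iff] at h
        have := (hw t htb).lintegral_ne_top le_rfl b le_rfl
        simp_all [hl.not_gt]
      · have hV := Vr_pos hr0 hr1 hv.1 ht.2
          (fun s hs => (hv.2 s ⟨ht.1.trans hs.1, hs.2.trans hxb⟩).1)
        rw [ENNReal.rpow_eq_zero_iff_of_pos (by positivity)] at h
        exact hV.ne' h

theorem C₄_eq (a b r p q : ℝ) (u v w : ℝ → ℝ≥0∞) :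
    C₄ a b r p q u v w = int₄ a b r p q u v w ^ ((p - q) / (p * q)) := rfl

theorem C₅_eq (a b r p q : ℝ) (u v w : ℝ → ℝ≥0∞) :
    C₅ a b r p q u v w = int₅ a b r p q u v w ^ ((p - q) / (p * q)) := rfl

/-- The factor relating `C₄ + C₅` to an admissible constant in the inequality. -/
def suffConst (p q : ℝ) : ℝ≥0∞ :=
  8 * 4 ^ (q / p) * ((2 ^ (q / (p - q))) ^ (1 - q / p) + 4 ^ (1 - q / p))

theorem suffConst_ne_top {p q : ℝ} (hq0 : 0 < q) (hqp : q < p) : suffConst p q ≠ ∞ := by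
  have hp0 : 0 < p := hq0.trans hqp
  have hpq : 0 < p - q := by linarith
  have hs1 : 0 ≤ 1 - q / p := sub_nonneg.2 ((div_le_one hp0).2 hqp.le)
  refine ENNReal.mul_ne_top (ENNReal.mul_ne_top (by norm_num)
    (ENNReal.rpow_ne_top_of_nonneg (by positivity) (by norm_num)))
    (ENNReal.add_ne_top.2 ⟨ENNReal.rpow_ne_top_of_nonneg hs1
      (ENNReal.rpow_ne_top_of_nonneg (by positivity) (by norm_num)),
      ENNReal.rpow_ne_top_of_nonneg hs1 (by norm_num)⟩)

theorem cesCesIneq_of_lt_top {p q r : ℝ} (hq0 : 0 < q) (hqp : q < p) (hpr : p ≤ r)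
    (hr1 : r ≤ 1) {u v w : ℝ → ℝ≥0∞} {a b : ℝ} (hab : a < b) (hu : IsWeight a b u)
    (hv : IsWeight a b v) (hw : ∀ α ∈ Ioo a b, HasTails w α b)
    (h4 : C₄ a b r p q u v w < ∞) :
    CesCesIneq a b r p q u v w
      (suffConst p q ^ (1 / q) * (C₄ a b r p q u v w + C₅ a b r p q u v w)) := by
  intro f hf
  have hp0 : 0 < p := hq0.trans hqp
  have hpq : 0 < p - q := by linarith
  have hr0 : 0 < r := hp0.trans_le hpr
  have hqr0 : 0 < q / r := div_pos hq0 hr0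
  have hs0 : 0 < q / p := div_pos hq0 hp0
  have hs1 : 0 ≤ 1 - q / p := sub_nonneg.2 ((div_le_one hp0).2 hqp.le)
  have he : (p - q) / (p * q) * q = 1 - q / p := by field_simp
  have h4' : int₄ a b r p q u v w < ∞ := by
    rwa [C₄_eq, ENNReal.rpow_lt_top_iff_of_pos (by positivity)] at h4
  set R := ∫⁻ t in Ioo a b, (∫⁻ s in Ioo a t, f s) ^ p * w t with hR
  have key : ∫⁻ t in Ioo a b, (∫⁻ s in Ioo a t, f s ^ r * v s) ^ (q / r) * u t ≤
      suffConst p q * R ^ (q / p) * (C₄ a b r p q u v w + C₅ a b r p q u v w) ^ q := by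
    refine lintegral_Ioo_le_of_left_limit hab
      (g := fun α t => (∫⁻ s in Ioo α t, f s ^ r * v s) ^ (q / r) * u t) ?_ ?_ ?_ ?_
    · exact fun α _ => ((monotone_lintegral_Ioo _ α).measurable.pow_const _).mul hu.1
    · intro α _ α' _ hαα t _
      gcongr
    · intro t ht
      rw [lintegral_Ioo_eq_iSup_left _ ht.1]
      have := (ENNReal.orderIsoRpow (q / r) hqr0).map_iSup₂
        (fun α (_ : α ∈ Ioo a t) => ∫⁻ s in Ioo α t, f s ^ r * v s)
      simp only [ENNReal.orderIsoRpow_apply] at this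
      rw [this, ENNReal.iSup_mul]
      refine iSup_mono fun α => ?_
      rw [ENNReal.iSup_mul]
    · intro α hα
      refine (lintegral_Ioo_le_of_int₄_int₅ hq0 hqp hpr hr1 hα
        (fun t ht => (hu.2 t ⟨hα.1.trans ht.1, ht.2⟩).1)
        (hasTails_of_int₄_lt_top hq0 hqp hpr hr1 hα hu hv hw h4') hv.1 hw hf).trans ?_
      rw [← hR, ENNReal.mul_rpow_of_nonneg _ _ hs0.le, ENNReal.mul_rpow_of_nonneg _ _ hs1,
        ENNReal.mul_rpow_of_nonneg _ _ hs1]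
      have e4 : int₄ a b r p q u v w ^ (1 - q / p) ≤
          (C₄ a b r p q u v w + C₅ a b r p q u v w) ^ q := by
        rw [← he, ENNReal.rpow_mul, ← C₄_eq]
        gcongr
        exact le_self_add
      have e5 : int₅ a b r p q u v w ^ (1 - q / p) ≤
          (C₄ a b r p q u v w + C₅ a b r p q u v w) ^ q := by
        rw [← he, ENNReal.rpow_mul, ← C₅_eq]
        gcongr
        exact le_add_self
      calc _ ≤ 8 * (4 ^ (q / p) * R ^ (q / p)) *
            ((2 ^ (q / (p - q))) ^ (1 - q / p) * (C₄ a b r p q u v w + C₅ a b r p q u v w) ^ q +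
              4 ^ (1 - q / p) * (C₄ a b r p q u v w + C₅ a b r p q u v w) ^ q) := by gcongr
        _ = _ := by
          rw [suffConst]
          ring
  have hq' : 0 ≤ 1 / q := by positivity
  refine (ENNReal.rpow_le_rpow key hq').trans (le_of_eq ?_)
  rw [ENNReal.mul_rpow_of_nonneg _ _ hq', ENNReal.mul_rpow_of_nonneg _ _ hq', ← ENNReal.rpow_mul,
    ← ENNReal.rpow_mul, mul_one_div_cancel hq0.ne', ENNReal.rpow_one,
    show q / p * (1 / q) = 1 / p by field_simp]
  ring

/-- The Cesàro-type inequality tested on finite sums of functions supported to the right of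
prescribed points. -/
def TestBound (p q r : ℝ) (u v W : ℝ → ℝ≥0∞) (α β : ℝ) (N : ℝ≥0∞) : Prop :=
  ∀ (n : ℕ) (f : ℕ → ℝ → ℝ≥0∞) (τ : ℕ → ℝ), (∀ k, Measurable (f k)) → (∀ k, τ k ∈ Ico α β) →
    (∀ k, ∀ t ∉ Ioo (τ k) β, f k t = 0) →
    ∑ k ∈ Finset.range n, (∫⁻ t, f k t) ^ p * W (τ k) ≠ ∞ →
    ∫⁻ t in Ioo α β, (∫⁻ s in Ioo α t, (∑ k ∈ Finset.range n, f k s) ^ r * v s) ^ (q / r) * u t ≤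
      N * (∑ k ∈ Finset.range n, (∫⁻ t, f k t) ^ p * W (τ k)) ^ (q / p)

theorem TestBound.Vr_lt_top {p q r : ℝ} (hq0 : 0 < q) (hp0 : 0 < p) (hr0 : 0 < r) (hr1 : r ≤ 1)
    {u v W : ℝ → ℝ≥0∞} {α β : ℝ} {N : ℝ≥0∞} (hN : N ≠ ∞) (hu : HasTails u α β)
    (hv : Measurable v) (hvt : ∀ t ∈ Ioo α β, v t ≠ ∞) (hWt : ∀ t ∈ Ico α β, W t ≠ ∞)
    (H : TestBound p q r u v W α β N) {τ t : ℝ} (hτ : α ≤ τ) (ht : t < β) :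
    Vr r v τ t < ∞ := by
  rcases le_or_gt t τ with h | hτt
  · refine lt_of_le_of_lt ?_ (show (0 : ℝ≥0∞) < ∞ by simp)
    rcases eq_or_lt_of_le hr1 with h1 | h1
    · subst h1
      simp [Vr_one, Ioo_eq_empty (not_lt.2 h)]
    · have : 0 < (1 - r) / r := div_pos (by linarith) hr0
      simp [Vr_of_lt_one h1, Ioo_eq_empty (not_lt.2 h), this]
  have hU := hu.pos (x := t) ⟨hτ.trans hτt.le, ht⟩
  have hUt := hu.lintegral_ne_top (hτ.trans hτt.le) β le_rfl
  have hτm : τ ∈ Ico α β := ⟨hτ, hτt.trans ht⟩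
  have hqr0 : 0 < q / r := div_pos hq0 hr0
  have key : Vr r v τ t ≤ (N * W τ ^ (q / p) / ∫⁻ s in Ioo t β, u s) ^ q⁻¹ := by
    refine le_of_forall_lt fun X hX => ?_
    obtain ⟨Y, hXY, hY⟩ := exists_between hX
    refine hXY.trans_le ?_
    obtain ⟨f, hf, hf0, hf1, hfY⟩ := exists_rpow_le_lintegral_of_lt_Vr hr0 hr1 hv
      (fun s hs => hvt s ⟨hτ.trans_lt hs.1, hs.2.trans ht⟩) hY
    rw [ENNReal.le_rpow_inv_iff hq0, ENNReal.le_div_iff_mul_le (Or.inl hU.ne') (Or.inl hUt)]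
    have hS : (∫⁻ t, f t) ^ p * W τ ≤ W τ :=
      mul_le_of_le_one_left' (ENNReal.rpow_le_one hf1 hp0.le)
    have h := H 1 (fun _ => f) (fun _ => τ) (fun _ => hf) (fun _ => hτm)
      (fun _ s hs => hf0 s fun hs' => hs ⟨hs'.1, hs'.2.trans ht⟩)
      (by simpa using (hS.trans_lt (hWt τ hτm).lt_top).ne)
    simp only [Finset.sum_range_one] at h
    calc Y ^ q * ∫⁻ s in Ioo t β, u s = ∫⁻ s in Ioo t β, (Y ^ r) ^ (q / r) * u s := by
          rw [← ENNReal.rpow_mul, mul_div_cancel₀ _ hr0.ne', lintegral_const_mul _ hu.meas]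
      _ ≤ ∫⁻ x in Ioo t β, (∫⁻ s in Ioo α x, f s ^ r * v s) ^ (q / r) * u x := by
          refine setLIntegral_mono' measurableSet_Ioo fun x hx => ?_
          gcongr
          exact hfY.trans (lintegral_mono_set (Ioo_subset_Ioo hτ hx.1.le))
      _ ≤ _ := (lintegral_mono_set (Ioo_subset_Ioo_left (hτ.trans hτt.le))).trans h
      _ ≤ _ := by gcongr
  refine key.trans_lt ((ENNReal.rpow_lt_top_iff_of_pos (inv_pos.2 hq0)).2 ?_)
  exact ENNReal.div_lt_top (ENNReal.mul_ne_top hN (ENNReal.rpow_ne_top_of_nonneg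
    (by positivity) (hWt τ hτm))) hU.ne'

theorem one_le_rpow_of_one_le {x : ℝ≥0∞} {s : ℝ} (hx : 1 ≤ x) (hs : 0 ≤ s) : 1 ≤ x ^ s := by
  simpa using ENNReal.rpow_le_rpow hx hs

theorem supVr_le_add {p r : ℝ} (hp0 : 0 ≤ p) (hp1 : p ≤ 1) (hr0 : 0 < r) (hr1 : r ≤ 1)
    {v W : ℝ → ℝ≥0∞} {α y y' : ℝ} (hαy : α ≤ y) (hyy : y < y')
    (hW : ∀ s ∈ Ico α y', ∀ t ∈ Ico α y', s ≤ t → W t ≤ W s) :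
    supVr p r v W α y' ≤ (2 ^ ((1 - r) / r)) ^ p * (supVr p r v W α y + supVr p r v W y y') := by
  have hγ : 0 ≤ (1 - r) / r := div_nonneg (by linarith) hr0.le
  have hc : 1 ≤ (2 ^ ((1 - r) / r) : ℝ≥0∞) ^ p := by
    refine one_le_rpow_of_one_le (one_le_rpow_of_one_le (by norm_num) hγ) hp0
  refine iSup₂_le fun t ht => ?_
  rcases lt_or_ge t y with hty | hty
  · calc (W t)⁻¹ * Vr r v t y' ^ p
        ≤ (W t)⁻¹ * (2 ^ ((1 - r) / r) * (Vr r v t y + Vr r v y y')) ^ p := by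
          gcongr
          exact Vr_le_add hr0 hr1 v hty.le hyy.le
      _ = (2 ^ ((1 - r) / r)) ^ p * ((W t)⁻¹ * (Vr r v t y + Vr r v y y') ^ p) := by
          rw [ENNReal.mul_rpow_of_nonneg _ _ hp0, mul_left_comm]
      _ ≤ (2 ^ ((1 - r) / r)) ^ p *
            ((W t)⁻¹ * Vr r v t y ^ p + (W y)⁻¹ * Vr r v y y' ^ p) := by
          gcongr
          calc _ ≤ (W t)⁻¹ * (Vr r v t y ^ p + Vr r v y y' ^ p) := by
                gcongr
                exact ENNReal.rpow_add_le_add_rpow _ _ hp0 hp1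
            _ ≤ _ := by
                rw [mul_add]
                gcongr
                exact hW t ht y ⟨hαy, hyy⟩ hty.le
      _ ≤ _ := by
          gcongr
          exacts [le_supVr ⟨ht.1, hty⟩, le_supVr ⟨le_rfl, hyy⟩]
  · refine (le_supVr (α := y) ⟨hty, ht.2⟩).trans ?_
    exact le_add_self.trans (le_mul_of_one_le_left' hc)

/-- The constant in the quasi-triangle inequality for powers of `supVr`. -/
def supConst (p r l : ℝ) : ℝ≥0∞ := ((2 ^ ((1 - r) / r)) ^ p) ^ l * 2 ^ l

theorem supConst_ne_top {p r l : ℝ} (hp0 : 0 ≤ p) (hr0 : 0 < r) (hr1 : r ≤ 1) (hl : 0 ≤ l) :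
    supConst p r l ≠ ∞ :=
  ENNReal.mul_ne_top (ENNReal.rpow_ne_top_of_nonneg hl (ENNReal.rpow_ne_top_of_nonneg hp0
    (ENNReal.rpow_ne_top_of_nonneg (div_nonneg (by linarith) hr0.le) (by norm_num))))
    (ENNReal.rpow_ne_top_of_nonneg hl (by norm_num))

theorem supConst_ne_zero {p r l : ℝ} (hp0 : 0 ≤ p) (hr0 : 0 < r) (hr1 : r ≤ 1) (hl : 0 ≤ l) :
    supConst p r l ≠ 0 := by
  have hγ : 0 ≤ (1 - r) / r := div_nonneg (by linarith) hr0.le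
  refine (zero_lt_one.trans_le ?_).ne'
  exact one_le_mul (one_le_rpow_of_one_le (one_le_rpow_of_one_le
    (one_le_rpow_of_one_le (by norm_num) hγ) hp0) hl) (one_le_rpow_of_one_le (by norm_num) hl)

/-- Nearly extremal functions for a local supremum of `W⁻¹ V_r^p`. -/
theorem exists_test_function {p r : ℝ} (hr0 : 0 < r) (hr1 : r ≤ 1)
    {v W : ℝ → ℝ≥0∞} {x y : ℝ} (hxy : x < y) (hv : Measurable v) (hvt : ∀ t ∈ Ioo x y, v t ≠ ∞)
    (hV : Vr r v x y ≠ ∞) (hσ : supVr p r v W x y ≠ ∞) :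
    ∃ τ ∈ Ico x y, ∃ φ : ℝ → ℝ≥0∞, Measurable φ ∧ (∀ t ∉ Ioo τ y, φ t = 0) ∧ ∫⁻ t, φ t ≤ 1 ∧
      supVr p r v W x y ≤ 2 * ((W τ)⁻¹ * Vr r v τ y ^ p) ∧
      (Vr r v τ y / 2) ^ r ≤ ∫⁻ t in Ioo τ y, φ t ^ r * v t := by
  obtain ⟨τ, hτ, hτσ⟩ : ∃ τ ∈ Ico x y, supVr p r v W x y ≤ 2 * ((W τ)⁻¹ * Vr r v τ y ^ p) := by
    rcases eq_or_ne (supVr p r v W x y) 0 with h0 | h0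
    · exact ⟨x, ⟨le_rfl, hxy⟩, by simp [h0]⟩
    · have h := ENNReal.half_lt_self h0 hσ
      conv_rhs at h => rw [supVr]
      simp only [lt_iSup_iff] at h
      obtain ⟨τ, hτ, h⟩ := h
      refine ⟨τ, hτ, ?_⟩
      have := ENNReal.div_le_iff_le_mul (Or.inl (by norm_num)) (Or.inl (by norm_num)) |>.1 h.le
      rwa [mul_comm] at this
  have hVτ : Vr r v τ y ≠ ∞ := ((Vr_mono hr0 hr1 v hτ.1 le_rfl).trans_lt hV.lt_top).ne
  rcases eq_or_ne (Vr r v τ y) 0 with h0 | h0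
  · exact ⟨τ, hτ, 0, measurable_const, by simp, by simp, hτσ, by simp [h0, hr0]⟩
  · obtain ⟨φ, h1, h2, h3, h4⟩ := exists_rpow_le_lintegral_of_lt_Vr hr0 hr1 hv
      (fun s hs => hvt s ⟨hτ.1.trans_lt hs.1, hs.2⟩) (ENNReal.half_lt_self h0 hVτ)
    exact ⟨τ, hτ, φ, h1, h2, h3, hτσ, h4⟩

theorem supVr_lt_top {p r : ℝ} (hp0 : 0 < p) (hr0 : 0 < r) (hr1 : r ≤ 1)
    {v W : ℝ → ℝ≥0∞} {x y : ℝ} (hV : Vr r v x y ≠ ∞)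
    (hW0 : W y ≠ 0) (hW : ∀ t ∈ Ico x y, W y ≤ W t) :
    supVr p r v W x y < ∞ := by
  refine lt_of_le_of_lt (b := (W y)⁻¹ * Vr r v x y ^ p) (iSup₂_le fun t ht => ?_)
    (ENNReal.mul_lt_top (ENNReal.inv_lt_top.2 (pos_iff_ne_zero.2 hW0))
      (ENNReal.rpow_lt_top_of_nonneg hp0.le hV))
  gcongr
  · exact hW t ht
  · exact Vr_mono hr0 hr1 v ht.1 le_rfl

theorem TestBound.lintegral_supVr_le {p q r : ℝ} (hq0 : 0 < q) (hqp : q < p) (hp1 : p ≤ 1)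
    (hr0 : 0 < r) (hr1 : r ≤ 1)
    {u v W : ℝ → ℝ≥0∞} {α β : ℝ} {N : ℝ≥0∞} (hu : HasTails u α β)
    (hv : Measurable v) (hvt : ∀ t ∈ Ioo α β, v t ≠ ∞) (hWt : ∀ t ∈ Ico α β, W t ≠ ∞)
    (hW0 : ∀ t ∈ Ico α β, W t ≠ 0) (hWm : ∀ s ∈ Ico α β, ∀ t ∈ Ico α β, s ≤ t → W t ≤ W s)
    (H : TestBound p q r u v W α β N) :
    ∫⁻ x in Ioo α β, (∫⁻ s in Ioo x β, u s) ^ (q / (p - q)) * u x *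
        supVr p r v W α x ^ (q / (p - q)) ≤
      2 * supConst p r (q / (p - q)) *
        ((2 * supConst p r (q / (p - q)) + 2) ^ 2 * (2 ^ (q / p) * 2 ^ q) * N) ^
          (p / (p - q)) := by
  have hp0 : 0 < p := hq0.trans hqp
  have hpq : 0 < p - q := by linarith
  have hl : 0 < q / (p - q) := div_pos hq0 hpq
  have hs0 : 0 < q / p := div_pos hq0 hp0
  have hs1 : q / p < 1 := (div_lt_one hp0).2 hqp
  have hqr0 : 0 < q / r := div_pos hq0 hr0
  set l := q / (p - q) with hldef
  set c := supConst p r l with hc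
  have hct : c ≠ ∞ := supConst_ne_top hp0.le hr0 hr1 hl.le
  have hc0 : c ≠ 0 := supConst_ne_zero hp0.le hr0 hr1 hl.le
  set K := 2 * c + 2 with hK
  have hK2 : 2 ≤ K := le_add_self
  have hKt : K ≠ ∞ := by finiteness
  rcases eq_or_ne N ∞ with rfl | hN
  · have : (2 : ℝ≥0∞) ^ (q / p) * 2 ^ q ≠ 0 := by
      simp [ENNReal.rpow_eq_zero_iff]
    have h1 : K ^ 2 * ((2 : ℝ≥0∞) ^ (q / p) * 2 ^ q) ≠ 0 :=
      mul_ne_zero (pow_ne_zero _ (by simp [hK])) this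
    rw [ENNReal.mul_top h1, ENNReal.top_rpow_of_pos (div_pos hp0 hpq),
      ENNReal.mul_top (mul_ne_zero (by simp) hc0)]
    exact le_top
  obtain ⟨t, ht, hlev⟩ := hu.exists_partition hK2 hKt
  set G : ℕ → ℝ≥0∞ := fun k => ∫⁻ s in Ioo (t k) β, u s with hG
  have hG0 : ∀ k, G k ≠ 0 := fun k => (hu.pos (ht.mem k)).ne'
  have hGt : ∀ k, G k ≠ ∞ := fun k => hu.lintegral_ne_top (ht.le k) β le_rfl
  have hV : ∀ k, Vr r v (t k) (t (k + 1)) ≠ ∞ := fun k =>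
    (H.Vr_lt_top hq0 hp0 hr0 hr1 hN hu hv hvt hWt (ht.le k) (ht.lt (k + 1))).ne
  set σ : ℕ → ℝ≥0∞ := fun k => supVr p r v W (t k) (t (k + 1)) with hσ
  have hσt : ∀ k, σ k ≠ ∞ := fun k =>
    (supVr_lt_top hp0 hr0 hr1 (hV k) (hW0 _ (ht.mem _)) fun s hs =>
      hWm s ⟨(ht.le k).trans hs.1, hs.2.trans (ht.lt _)⟩ _ (ht.mem _) hs.2.le).ne
  set B : ℕ → ℝ≥0∞ := fun k => G k ^ (l + 1) * σ k ^ l with hB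
  have hBt : ∀ k, B k ≠ ∞ := fun k => ENNReal.mul_ne_top
    (ENNReal.rpow_ne_top_of_nonneg (by positivity) (hGt k))
    (ENNReal.rpow_ne_top_of_nonneg hl.le (hσt k))
  have hstep1 : ∫⁻ x in Ioo α β, (∫⁻ s in Ioo x β, u s) ^ l * u x * supVr p r v W α x ^ l ≤
      ∑' k, G k ^ (l + 1) * supVr p r v W α (t (k + 1)) ^ l := by
    rw [← ht.tsum_lintegral]
    refine ENNReal.tsum_le_tsum fun k => ?_
    calc _ ≤ ∫⁻ x in Ioo (t k) (t (k + 1)), G k ^ l * supVr p r v W α (t (k + 1)) ^ l * u x := by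
          refine setLIntegral_mono' measurableSet_Ioo fun x hx => ?_
          rw [mul_right_comm]
          gcongr
          · exact lintegral_mono_set (Ioo_subset_Ioo_left hx.1.le)
          · exact supVr_mono hp0.le hr0 hr1 le_rfl hx.2.le
      _ ≤ G k ^ l * supVr p r v W α (t (k + 1)) ^ l * G k := by
          rw [lintegral_const_mul _ hu.meas]
          gcongr
          exact lintegral_mono_set (Ioo_subset_Ioo_right (ht.lt _).le)
      _ = _ := by
          rw [ENNReal.rpow_add _ _ (hG0 k) (hGt k), ENNReal.rpow_one]
          ring
  have hstep2 : ∑' k, G k ^ (l + 1) * supVr p r v W α (t (k + 1)) ^ l ≤ 2 * c * ∑' k, B k := by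
    refine tsum_mul_le_of_recursion (g := fun k => G k ^ (l + 1))
      (E := fun k => supVr p r v W α (t k) ^ l) (s := fun k => σ k ^ l) (c := c) ?_ ?_ ?_
    · intro k
      have : G k = K * G (k + 1) := (hlev k).symm
      rw [this, ENNReal.mul_rpow_of_nonneg _ _ (by positivity)]
      gcongr
      calc 2 * c ≤ K := le_self_add
        _ = K ^ (1 : ℝ) := (ENNReal.rpow_one K).symm
        _ ≤ _ := ENNReal.rpow_le_rpow_of_exponent_le (le_trans (by norm_num) hK2) (by linarith)
    · simp [ht.zero, supVr, hl]
    · intro k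
      rw [hc, supConst, mul_assoc]
      refine (ENNReal.rpow_le_rpow (supVr_le_add hp0.le hp1 hr0 hr1 (ht.le k) (ht.lt_succ k)
        fun s hs s' hs' h => hWm s ⟨hs.1, hs.2.trans (ht.lt _)⟩ s' ⟨hs'.1, hs'.2.trans (ht.lt _)⟩ h)
        hl.le).trans ?_
      rw [ENNReal.mul_rpow_of_nonneg _ _ hl.le]
      gcongr
      exact rpow_add_le_two_rpow_mul hl.le _ _
  have hstep3 : ∑' k, B k ≤ (K ^ 2 * (2 ^ (q / p) * 2 ^ q) * N) ^ (1 / (1 - q / p)) := by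
    refine tsum_le_rpow_of_sum_le hBt hs1 fun n => ?_
    choose τ hτ φ hφ hφ0 hφ1 hτσ hφV using fun k => exists_test_function (p := p) (W := W) hr0 hr1
      (ht.lt_succ k) hv (fun s hs => hvt s ⟨(ht.le k).trans_lt hs.1, hs.2.trans (ht.lt _)⟩)
      (hV k) (hσt k)
    have hτm : ∀ k, τ k ∈ Ico α β := fun k => ⟨(ht.le k).trans (hτ k).1, (hτ k).2.trans (ht.lt _)⟩
    set d : ℕ → ℝ≥0∞ := fun k => (B k / W (τ k)) ^ p⁻¹ with hd
    have hdp : ∀ k, d k ^ p * W (τ k) = B k := fun k => by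
      rw [hd]
      dsimp only
      rw [← ENNReal.rpow_mul, inv_mul_cancel₀ hp0.ne', ENNReal.rpow_one,
        ENNReal.div_mul_cancel (hW0 _ (hτm k)) (hWt _ (hτm k))]
    have hS : ∑ k ∈ Finset.range n, (∫⁻ s, d k * φ k s) ^ p * W (τ k) ≤
        ∑ k ∈ Finset.range n, B k := by
      refine Finset.sum_le_sum fun k _ => ?_
      rw [lintegral_const_mul _ (hφ k), ← hdp k]
      gcongr
      exact mul_le_of_le_one_right' (hφ1 k)
    have hT := H n (fun k s => d k * φ k s) τ (fun k => (hφ k).const_mul _) hτm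
      (fun k s hs => by
        rw [hφ0 k s fun hs' => hs ⟨hs'.1, hs'.2.trans (ht.lt _)⟩, mul_zero])
      (hS.trans_lt (ENNReal.sum_lt_top.2 fun k _ => (hBt k).lt_top)).ne
    have hlow : ∑ k ∈ Finset.range n, B k ≤ K ^ 2 * (2 ^ (q / p) * 2 ^ q) *
        ∫⁻ x in Ioo α β, (∫⁻ s in Ioo α x, (∑ k ∈ Finset.range n, d k * φ k s) ^ r * v s) ^ (q / r)
          * u x := by
      have hB1 : ∀ k, B k ≤ K ^ 2 * (2 ^ (q / p) * 2 ^ q) *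
          ((d k * (Vr r v (τ k) (t (k + 1)) / 2)) ^ q *
            ∫⁻ x in Ioo (t (k + 1)) (t (k + 1 + 1)), u x) := by
        intro k
        have hGK : G k ≤ K ^ 2 * ∫⁻ x in Ioo (t (k + 1)) (t (k + 1 + 1)), u x := by
          calc G k = K ^ 2 * G (k + 1 + 1) := by
                rw [sq, mul_assoc]
                exact ((congrArg (K * ·) (hlev (k + 1))).trans (hlev k)).symm
            _ ≤ _ := by
                gcongr
                exact hu.lintegral_le_of_level (ht.le _) (ht.lt_succ _).le (ht.lt _).le hK2
                  (hlev _)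
        have hs1' : 0 ≤ 1 - q / p := by linarith
        have e1 : B k ^ (q / p) = d k ^ q * W (τ k) ^ (q / p) := by
          rw [← hdp k, ENNReal.mul_rpow_of_nonneg _ _ hs0.le, ← ENNReal.rpow_mul,
            mul_div_cancel₀ _ hp0.ne']
        have e2 : B k ^ (1 - q / p) = G k * σ k ^ (q / p) := by
          rw [hB]
          dsimp only
          have h1 : (l + 1) * (1 - q / p) = 1 := by rw [hldef]; field_simp; ring
          have h2 : l * (1 - q / p) = q / p := by rw [hldef]; field_simp
          rw [ENNReal.mul_rpow_of_nonneg _ _ hs1', ← ENNReal.rpow_mul, ← ENNReal.rpow_mul, h1, h2,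
            ENNReal.rpow_one]
        have e3 : σ k ^ (q / p) ≤
            2 ^ (q / p) * (W (τ k) ^ (-(q / p)) * Vr r v (τ k) (t (k + 1)) ^ q) := by
          refine (ENNReal.rpow_le_rpow (hτσ k) hs0.le).trans (le_of_eq ?_)
          rw [ENNReal.mul_rpow_of_nonneg _ _ hs0.le, inv_mul_rpow_rpow _ _ _ hs0.le,
            mul_div_cancel₀ _ hp0.ne']
        have e4 : Vr r v (τ k) (t (k + 1)) ^ q = 2 ^ q * (Vr r v (τ k) (t (k + 1)) / 2) ^ q := by
          rw [← ENNReal.mul_rpow_of_nonneg _ _ hq0.le, ENNReal.mul_div_cancel (by simp) (by simp)]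
        have e5 : W (τ k) ^ (q / p) * W (τ k) ^ (-(q / p)) = 1 := by
          rw [← ENNReal.rpow_add _ _ (hW0 _ (hτm k)) (hWt _ (hτm k)), add_neg_cancel,
            ENNReal.rpow_zero]
        calc B k = B k ^ (q / p) * B k ^ (1 - q / p) := by
              rw [← ENNReal.rpow_add_of_nonneg _ _ hs0.le hs1', add_sub_cancel, ENNReal.rpow_one]
          _ ≤ d k ^ q * W (τ k) ^ (q / p) *
                ((K ^ 2 * ∫⁻ x in Ioo (t (k + 1)) (t (k + 1 + 1)), u x) *
                  (2 ^ (q / p) * (W (τ k) ^ (-(q / p)) *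
                    (2 ^ q * (Vr r v (τ k) (t (k + 1)) / 2) ^ q)))) := by
              rw [e1, e2, ← e4]
              gcongr
          _ = W (τ k) ^ (q / p) * W (τ k) ^ (-(q / p)) * (K ^ 2 * (2 ^ (q / p) * 2 ^ q) *
                (d k ^ q * (Vr r v (τ k) (t (k + 1)) / 2) ^ q *
                  ∫⁻ x in Ioo (t (k + 1)) (t (k + 1 + 1)), u x)) := by ring
          _ = _ := by rw [e5, one_mul, ENNReal.mul_rpow_of_nonneg _ _ hq0.le]
      refine (Finset.sum_le_sum fun k _ => hB1 k).trans ?_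
      rw [← Finset.mul_sum]
      gcongr
      refine le_trans ?_ (ht.tsum_lintegral_succ_le _)
      refine le_trans (Finset.sum_le_sum fun k hk => ?_) (ENNReal.sum_le_tsum (Finset.range n))
      rw [← lintegral_const_mul _ hu.meas]
      refine setLIntegral_mono' measurableSet_Ioo fun x hx => ?_
      gcongr
      calc (d k * (Vr r v (τ k) (t (k + 1)) / 2)) ^ q
          = (d k ^ r * (Vr r v (τ k) (t (k + 1)) / 2) ^ r) ^ (q / r) := by
            rw [← ENNReal.mul_rpow_of_nonneg _ _ hr0.le, ← ENNReal.rpow_mul,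
              mul_div_cancel₀ _ hr0.ne']
        _ ≤ _ := by
            gcongr
            calc d k ^ r * (Vr r v (τ k) (t (k + 1)) / 2) ^ r
                ≤ d k ^ r * ∫⁻ s in Ioo (τ k) (t (k + 1)), φ k s ^ r * v s := by
                  gcongr
                  exact hφV k
              _ = ∫⁻ s in Ioo (τ k) (t (k + 1)), (d k * φ k s) ^ r * v s := by
                  rw [← lintegral_const_mul (d k ^ r) (f := fun s => φ k s ^ r * v s)
                    (((hφ k).pow_const _).mul hv)]
                  refine lintegral_congr fun s => ?_
                  rw [ENNReal.mul_rpow_of_nonneg _ _ hr0.le, mul_assoc]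
              _ ≤ ∫⁻ s in Ioo (τ k) (t (k + 1)),
                    (∑ k ∈ Finset.range n, d k * φ k s) ^ r * v s := by
                  gcongr with s
                  exact Finset.single_le_sum (f := fun k => d k * φ k s) (fun _ _ => zero_le) hk
              _ ≤ _ := lintegral_mono_set (Ioo_subset_Ioo (hτm k).1 hx.1.le)
    refine hlow.trans ?_
    rw [mul_assoc _ N]
    gcongr
    exact hT.trans (by gcongr)
  have he : 1 / (1 - q / p) = p / (p - q) := by field_simp
  rw [he] at hstep3
  exact hstep1.trans (hstep2.trans (by gcongr))

/-- The constant in the necessity part for the supremum functional. -/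
def supNecConst (p q r : ℝ) : ℝ≥0∞ :=
  2 * supConst p r (q / (p - q)) *
    ((2 * supConst p r (q / (p - q)) + 2) ^ 2 * (2 ^ (q / p) * 2 ^ q)) ^ (p / (p - q))

theorem supNecConst_ne_top {p q r : ℝ} (hq0 : 0 < q) (hqp : q < p) (hr0 : 0 < r) (hr1 : r ≤ 1) :
    supNecConst p q r ≠ ∞ := by
  have hp0 : 0 < p := hq0.trans hqp
  have hpq : 0 < p - q := by linarith
  have hc := supConst_ne_top (l := q / (p - q)) hp0.le hr0 hr1 (by positivity)
  have h1 : (2 : ℝ≥0∞) ^ (q / p) ≠ ∞ :=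
    ENNReal.rpow_ne_top_of_nonneg (by positivity) (by norm_num)
  have h2 : (2 : ℝ≥0∞) ^ q ≠ ∞ := ENNReal.rpow_ne_top_of_nonneg hq0.le (by norm_num)
  exact ENNReal.mul_ne_top (by finiteness)
    (ENNReal.rpow_ne_top_of_nonneg (by positivity) (by finiteness))

theorem TestBound.lintegral_supVr_le' {p q r : ℝ} (hq0 : 0 < q) (hqp : q < p) (hp1 : p ≤ 1)
    (hr0 : 0 < r) (hr1 : r ≤ 1)
    {u v W : ℝ → ℝ≥0∞} {α β : ℝ} {N : ℝ≥0∞} (hu : HasTails u α β)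
    (hv : Measurable v) (hvt : ∀ t ∈ Ioo α β, v t ≠ ∞) (hWt : ∀ t ∈ Ico α β, W t ≠ ∞)
    (hW0 : ∀ t ∈ Ico α β, W t ≠ 0) (hWm : ∀ s ∈ Ico α β, ∀ t ∈ Ico α β, s ≤ t → W t ≤ W s)
    (H : TestBound p q r u v W α β N) :
    ∫⁻ x in Ioo α β, (∫⁻ s in Ioo x β, u s) ^ (q / (p - q)) * u x *
        supVr p r v W α x ^ (q / (p - q)) ≤ supNecConst p q r * N ^ (p / (p - q)) := by
  refine (H.lintegral_supVr_le hq0 hqp hp1 hr0 hr1 hu hv hvt hWt hW0 hWm).trans (le_of_eq ?_)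
  have hp0 : 0 < p := hq0.trans hqp
  have hpq : 0 < p - q := by linarith
  rw [supNecConst, ENNReal.mul_rpow_of_nonneg _ N (by positivity), mul_assoc]
  ring

/-- The left-hand side of the inequality on a block. -/
def blockFun (q r : ℝ) (u v : ℝ → ℝ≥0∞) (x y : ℝ) (f : ℝ → ℝ≥0∞) : ℝ≥0∞ :=
  ∫⁻ t in Ioo x y, (∫⁻ s in Ioo x t, f s ^ r * v s) ^ (q / r) * u t

/-- The best constant of the inequality on a block, raised to the power `q`. -/
def blockNorm (q r : ℝ) (u v : ℝ → ℝ≥0∞) (x y : ℝ) : ℝ≥0∞ :=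
  ⨆ (f : ℝ → ℝ≥0∞) (_ : Measurable f ∧ (∀ t ∉ Ioo x y, f t = 0) ∧ ∫⁻ t, f t ≤ 1),
    blockFun q r u v x y f

theorem blockFun_const_mul {q r : ℝ} (hq0 : 0 < q) (hr0 : 0 < r) {u v : ℝ → ℝ≥0∞}
    (hu : Measurable u) (hv : Measurable v) (x y : ℝ) {f : ℝ → ℝ≥0∞} (hf : Measurable f)
    (c : ℝ≥0∞) :
    blockFun q r u v x y (fun t => c * f t) = c ^ q * blockFun q r u v x y f := by
  have hqr : 0 < q / r := div_pos hq0 hr0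
  have hm : Measurable fun t => (∫⁻ s in Ioo x t, f s ^ r * v s) ^ (q / r) * u t :=
    ((monotone_lintegral_Ioo _ x).measurable.pow_const _).mul hu
  rw [blockFun, blockFun, ← lintegral_const_mul _ hm]
  refine lintegral_congr fun t => ?_
  have : ∫⁻ s in Ioo x t, (c * f s) ^ r * v s = c ^ r * ∫⁻ s in Ioo x t, f s ^ r * v s := by
    rw [← lintegral_const_mul _ (show Measurable fun s => f s ^ r * v s from
      (hf.pow_const _).mul hv)]
    refine lintegral_congr fun s => ?_
    rw [ENNReal.mul_rpow_of_nonneg _ _ hr0.le, mul_assoc]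
  rw [this, ENNReal.mul_rpow_of_nonneg _ _ hqr.le, ← ENNReal.rpow_mul, mul_div_cancel₀ _ hr0.ne',
    mul_assoc]

theorem blockFun_le_blockNorm_mul {q r : ℝ} (hq0 : 0 < q) (hr0 : 0 < r) {u v : ℝ → ℝ≥0∞}
    (hu : Measurable u) (hv : Measurable v) {x y : ℝ} {f : ℝ → ℝ≥0∞} (hf : Measurable f)
    (hf0 : ∀ t ∉ Ioo x y, f t = 0) (hft : ∫⁻ t, f t ≠ ∞) :
    blockFun q r u v x y f ≤ blockNorm q r u v x y * (∫⁻ t, f t) ^ q := by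
  rcases eq_or_ne (∫⁻ t, f t) 0 with h0 | h0
  · have hfz : f =ᵐ[volume] 0 := (lintegral_eq_zero_iff hf).1 h0
    have : blockFun q r u v x y f = 0 := by
      rw [blockFun]
      refine lintegral_eq_zero_of_ae_eq_zero (Filter.Eventually.of_forall fun t => ?_)
      have : ∫⁻ s in Ioo x t, f s ^ r * v s = 0 := by
        refine lintegral_eq_zero_of_ae_eq_zero (ae_restrict_of_ae ?_)
        filter_upwards [hfz] with s hs
        simp [hs, hr0]
      simp [this, div_pos hq0 hr0]
    rw [this]
    exact zero_le
  · set S := ∫⁻ t, f t with hS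
    have hf' : f = fun t => S * (S⁻¹ * f t) := by
      funext t
      rw [← mul_assoc, ENNReal.mul_inv_cancel h0 hft, one_mul]
    rw [hf', blockFun_const_mul hq0 hr0 hu hv _ _ (hf.const_mul _), mul_comm]
    gcongr
    refine le_iSup₂ (f := fun (f : ℝ → ℝ≥0∞) (_ : Measurable f ∧ (∀ t ∉ Ioo x y, f t = 0) ∧
      ∫⁻ t, f t ≤ 1) => blockFun q r u v x y f) (fun t => S⁻¹ * f t)
      ⟨hf.const_mul _, fun t ht => by simp [hf0 t ht], ?_⟩
    rw [lintegral_const_mul _ hf, ENNReal.inv_mul_cancel h0 hft]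

theorem testBound_blockNorm {q r : ℝ} (hq0 : 0 < q) (hr0 : 0 < r) {u v : ℝ → ℝ≥0∞}
    (hu : Measurable u) (hv : Measurable v) (x y : ℝ) :
    TestBound 1 q r u v (fun _ => 1) x y (blockNorm q r u v x y) := by
  intro n f τ hf hτ hf0 hS
  have hint : ∑ k ∈ Finset.range n, (∫⁻ t, f k t) ^ (1 : ℝ) * 1 =
      ∫⁻ t, ∑ k ∈ Finset.range n, f k t := by
    rw [lintegral_finsetSum _ fun k _ => hf k]
    simp
  rw [hint] at hS ⊢
  rw [div_one]
  refine blockFun_le_blockNorm_mul hq0 hr0 hu hv (Finset.measurable_fun_sum _ fun k _ => hf k) ?_ hS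
  intro t ht
  exact Finset.sum_eq_zero fun k _ => hf0 k t fun h => ht ⟨(hτ k).1.trans_lt h.1, h.2⟩

theorem localInt_le_blockNorm {q r : ℝ} (hq0 : 0 < q) (hq1 : q < 1) (hr0 : 0 < r) (hr1 : r ≤ 1)
    {u v : ℝ → ℝ≥0∞} {x y : ℝ} (hu : HasTails u x y)
    (hv : Measurable v) (hvt : ∀ t ∈ Ioo x y, v t ≠ ∞) :
    localInt q r u v x y ≤ supNecConst 1 q r * blockNorm q r u v x y ^ (1 / (1 - q)) := by
  refine le_trans (setLIntegral_mono' measurableSet_Ioo fun t ht => ?_)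
    ((testBound_blockNorm hq0 hr0 hu.meas hv x y).lintegral_supVr_le' hq0 hq1 le_rfl hr0 hr1 hu hv
      hvt (by simp) (by simp) (by simp))
  have : 0 < q / (1 - q) := div_pos hq0 (by linarith)
  gcongr
  refine le_trans (le_of_eq ?_) (le_supVr (t := x) ⟨le_rfl, ht.1⟩)
  simp

theorem CesCesIneq.test_le {p q r : ℝ} (hq0 : 0 < q) (hp0 : 0 < p) (hp1 : p ≤ 1)
    {u v w : ℝ → ℝ≥0∞} {a b : ℝ} {C : ℝ≥0∞} (H : CesCesIneq a b r p q u v w C)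
    (hw : Measurable w) (n : ℕ) {f : ℕ → ℝ → ℝ≥0∞} {τ : ℕ → ℝ}
    (hf : ∀ k, Measurable (f k)) (hf0 : ∀ k, ∀ t ∉ Ioo (τ k) b, f k t = 0) :
    ∫⁻ t in Ioo a b, (∫⁻ s in Ioo a t, (∑ k ∈ Finset.range n, f k s) ^ r * v s) ^ (q / r) * u t ≤
      C ^ q * (∑ k ∈ Finset.range n, (∫⁻ t, f k t) ^ p * ∫⁻ s in Ioo (τ k) b, w s) ^ (q / p) := by
  have h := ENNReal.rpow_le_rpow (H (fun s => ∑ k ∈ Finset.range n, f k s)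
    (Finset.measurable_fun_sum _ fun k _ => hf k)) hq0.le
  rw [← ENNReal.rpow_mul, one_div_mul_cancel hq0.ne', ENNReal.rpow_one,
    ENNReal.mul_rpow_of_nonneg _ _ hq0.le, ← ENNReal.rpow_mul,
    show 1 / p * q = q / p by ring] at h
  refine h.trans ?_
  gcongr
  have hmeas : ∀ k, Measurable fun t => (∫⁻ s in Ioo a t, f k s) ^ p * w t := fun k =>
    ((monotone_lintegral_Ioo _ a).measurable.pow_const _).mul hw
  calc _ ≤ ∫⁻ t in Ioo a b, ∑ k ∈ Finset.range n, (∫⁻ s in Ioo a t, f k s) ^ p * w t := by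
        refine lintegral_mono fun t => ?_
        rw [lintegral_finsetSum _ fun k _ => hf k, ← Finset.sum_mul]
        gcongr
        exact rpow_sum_le_sum_rpow _ _ hp0 hp1
    _ = ∑ k ∈ Finset.range n, ∫⁻ t in Ioo a b, (∫⁻ s in Ioo a t, f k s) ^ p * w t :=
        lintegral_finsetSum _ fun k _ => hmeas k
    _ ≤ _ := by
        refine Finset.sum_le_sum fun k _ => ?_
        rw [← lintegral_const_mul _ hw, ← lintegral_indicator measurableSet_Ioo,
          ← lintegral_indicator measurableSet_Ioo]
        refine lintegral_mono fun t => indicator_apply_le' (fun ht => ?_) fun _ => zero_le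
        by_cases htk : τ k < t
        · rw [indicator_of_mem (show t ∈ Ioo (τ k) b from ⟨htk, ht.2⟩)]
          gcongr
          exact Measure.restrict_le_self
        · have : ∫⁻ s in Ioo a t, f k s = 0 := by
            rw [setLIntegral_congr_fun (g := 0) measurableSet_Ioo fun s hs =>
              hf0 k s fun h => htk (h.1.trans hs.2)]
            simp
          rw [this, ENNReal.zero_rpow_of_pos hp0, zero_mul]
          exact zero_le

theorem CesCesIneq.testBound {p q r : ℝ} (hq0 : 0 < q) (hp0 : 0 < p) (hp1 : p ≤ 1) (hr0 : 0 < r)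
    {u v w : ℝ → ℝ≥0∞} {a b : ℝ} {C : ℝ≥0∞} (H : CesCesIneq a b r p q u v w C)
    (hw : Measurable w) {α : ℝ} (hα : a ≤ α) :
    TestBound p q r u v (fun t => ∫⁻ s in Ioo t b, w s) α b (C ^ q) := by
  intro n f τ hf _ hf0 _
  refine le_trans ?_ (H.test_le hq0 hp0 hp1 hw n hf hf0)
  refine (lintegral_mono_set (Ioo_subset_Ioo_left hα)).trans' (lintegral_mono fun t => ?_)
  have : 0 < q / r := div_pos hq0 hr0
  gcongr

theorem CesCesIneq.hasTails {p q r : ℝ} (hq0 : 0 < q) (hp0 : 0 < p) (hp1 : p ≤ 1) (hr0 : 0 < r)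
    {u v w : ℝ → ℝ≥0∞} {a b : ℝ} {C : ℝ≥0∞} (hC : C ≠ ∞) (H : CesCesIneq a b r p q u v w C)
    (hu : IsWeight a b u) (hv : IsWeight a b v) (hw : ∀ α ∈ Ioo a b, HasTails w α b) {α : ℝ}
    (hα : α ∈ Ioo a b) : HasTails u α b := by
  refine hasTails_of_pos hα.2 hu.1 (fun t ht => (hu.2 t ⟨hα.1.trans ht.1, ht.2⟩).1) ?_
  obtain ⟨α', hα'⟩ := exists_between hα.1
  have hα'b : α' ∈ Ioo a b := ⟨hα'.1, hα'.2.trans hα.2⟩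
  have hqr : 0 < q / r := div_pos hq0 hr0
  have h := H.test_le hq0 hp0 hp1 (hw α hα).meas 1
    (f := fun _ => (Ioo α' α).indicator 1) (τ := fun _ => α')
    (fun _ => measurable_one.indicator measurableSet_Ioo)
    (fun _ t ht => indicator_of_notMem (fun ht' => ht ⟨ht'.1, ht'.2.trans hα.2⟩) _)
  simp only [Finset.sum_range_one] at h
  have hV : 0 < ∫⁻ s in Ioo α' α, v s := lintegral_Ioo_pos hv.1 hα'.2 fun t ht =>
    (hv.2 t ⟨hα'.1.trans ht.1, ht.2.trans hα.2⟩).1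
  have hlow : (∫⁻ s in Ioo α' α, v s) ^ (q / r) * ∫⁻ t in Ioo α b, u t < ∞ := by
    rw [← lintegral_const_mul _ hu.1]
    refine lt_of_le_of_lt ?_ (h.trans_lt ?_)
    · refine (setLIntegral_mono' measurableSet_Ioo fun t ht => ?_).trans
        (lintegral_mono_set (Ioo_subset_Ioo_left hα.1.le))
      gcongr ?_ ^ _ * _
      calc ∫⁻ s in Ioo α' α, v s
          = ∫⁻ s in Ioo α' α, (Ioo α' α).indicator 1 s ^ r * v s :=
            setLIntegral_congr_fun measurableSet_Ioo fun s hs => by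
              simp [indicator_of_mem hs]
        _ ≤ _ := lintegral_mono_set (Ioo_subset_Ioo hα'.1.le ht.1.le)
    · refine ENNReal.mul_lt_top (ENNReal.rpow_lt_top_of_nonneg hq0.le hC)
        (ENNReal.rpow_lt_top_of_nonneg (by positivity) (ENNReal.mul_ne_top
          (ENNReal.rpow_ne_top_of_nonneg hp0.le ?_)
          ((hw α' hα'b).lintegral_ne_top le_rfl _ le_rfl)))
      simp [lintegral_indicator measurableSet_Ioo]
  by_contra hU
  rw [not_lt, top_le_iff] at hU
  rw [hU, ENNReal.mul_top (by simp [ENNReal.rpow_eq_zero_iff, hV.ne', hqr.not_gt])] at hlow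
  exact lt_irrefl _ hlow

theorem CesCesIneq.lintegral_supVr_le {p q r : ℝ} (hq0 : 0 < q) (hqp : q < p) (hp1 : p ≤ 1)
    (hr0 : 0 < r) (hr1 : r ≤ 1)
    {u v w : ℝ → ℝ≥0∞} {a b : ℝ} {C : ℝ≥0∞} (hC : C ≠ ∞) (H : CesCesIneq a b r p q u v w C)
    (hu : IsWeight a b u) (hv : IsWeight a b v) (hw : ∀ α ∈ Ioo a b, HasTails w α b) {α : ℝ}
    (hα : α ∈ Ioo a b) :
    ∫⁻ x in Ioo α b, (∫⁻ s in Ioo x b, u s) ^ (q / (p - q)) * u x *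
        supVr p r v (fun t => ∫⁻ s in Ioo t b, w s) α x ^ (q / (p - q)) ≤
      supNecConst p q r * (C ^ q) ^ (p / (p - q)) := by
  have hp0 := hq0.trans hqp
  refine (H.testBound hq0 hp0 hp1 hr0 (hw α hα).meas hα.1.le).lintegral_supVr_le' hq0 hqp hp1
    hr0 hr1 (H.hasTails hq0 hp0 hp1 hr0 hC hu hv hw hα) hv.1
    (fun t ht => (hv.2 t ⟨hα.1.trans ht.1, ht.2⟩).2.ne)
    (fun t ht => (hw α hα).lintegral_ne_top ht.1 _ le_rfl) (fun t ht => ((hw α hα).pos ht).ne')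
    fun s _ t _ hst => lintegral_mono_set (Ioo_subset_Ioo_left hst)

theorem CesCesIneq.int₄_le {p q r : ℝ} (hq0 : 0 < q) (hqp : q < p) (hp1 : p ≤ 1)
    (hr0 : 0 < r) (hr1 : r ≤ 1) {u v w : ℝ → ℝ≥0∞} {a b : ℝ} (hab : a < b) {C : ℝ≥0∞} (hC : C ≠ ∞)
    (H : CesCesIneq a b r p q u v w C)
    (hu : IsWeight a b u) (hv : IsWeight a b v) (hw : ∀ α ∈ Ioo a b, HasTails w α b) :
    int₄ a b r p q u v w ≤ supNecConst p q r * (C ^ q) ^ (p / (p - q)) := by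
  have hp0 := hq0.trans hqp
  have hpq : 0 < p - q := by linarith
  have hl : 0 < q / (p - q) := div_pos hq0 hpq
  have hUm : Measurable fun x => ∫⁻ s in Ioo x b, u s :=
    Antitone.measurable fun x y hxy => lintegral_mono_set (Ioo_subset_Ioo_left hxy)
  refine lintegral_Ioo_le_of_left_limit hab
    (g := fun α x => (∫⁻ s in Ioo x b, u s) ^ (q / (p - q)) * u x *
        supVr p r v (fun t => ∫⁻ s in Ioo t b, w s) α x ^ (q / (p - q))) ?_ ?_ ?_ ?_
  · intro α _
    refine ((hUm.pow_const _).mul hu.1).mul (Measurable.pow_const ?_ _)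
    exact Monotone.measurable fun x y hxy => supVr_mono hp0.le hr0 hr1 le_rfl hxy
  · intro α _ α' _ h t _
    gcongr
    exact supVr_mono hp0.le hr0 hr1 h le_rfl
  · intro x hx
    simp only [← ENNReal.mul_iSup]
    gcongr
    refine essSup_le_of_ae_le _ ((ae_restrict_iff' measurableSet_Ioo).2
      (Filter.Eventually.of_forall fun t ht => ?_))
    refine le_iSup₂_of_le t ht ?_
    refine le_trans (le_of_eq ?_) (ENNReal.rpow_le_rpow (le_supVr (t := t) ⟨le_rfl, ht.2⟩) hl.le)
    rw [inv_mul_rpow_rpow _ _ _ hl.le, mul_div_assoc]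
  · exact fun α hα => H.lintegral_supVr_le hq0 hqp hp1 hr0 hr1 hC hu hv hw hα

theorem lintegral_rpow_mul_le_rpow_add_one {l : ℝ} (hl : 0 ≤ l) {u : ℝ → ℝ≥0∞} (hu : Measurable u)
    (x y : ℝ) :
    ∫⁻ t in Ioo x y, (∫⁻ s in Ioo t y, u s) ^ l * u t ≤ (∫⁻ t in Ioo x y, u t) ^ (l + 1) := by
  rw [ENNReal.rpow_add_of_nonneg _ _ hl zero_le_one, ENNReal.rpow_one, ← lintegral_const_mul _ hu]
  refine setLIntegral_mono' measurableSet_Ioo fun t ht => ?_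
  gcongr
  exact ht.1.le

/-- The constant in the quasi-additivity of `localInt`. -/
def locConst (q r : ℝ) : ℝ≥0∞ :=
  2 ^ (q / (1 - q)) * (2 + (2 ^ ((1 - r) / r)) ^ (q / (1 - q)))

theorem rpow_mul_lintegral_Vr_le {l r : ℝ} (hl : 0 ≤ l) (hr0 : 0 < r) (hr1 : r ≤ 1)
    {u v : ℝ → ℝ≥0∞} {y x : ℝ} (hu : HasTails u y x) (c : ℝ≥0∞) :
    ∫⁻ t in Ioo y x, c ^ l * u t * Vr r v y t ^ l ≤
      (∫⁻ t in Ioo y x, (∫⁻ s in Ioo t x, u s) ^ l * u t * Vr r v y t ^ l) +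
        Vr r v y x ^ l * c ^ (l + 1) := by
  have hbig : ∀ z, y ≤ z → ∫⁻ s in Ioo z x, u s ≤ c →
      ∫⁻ t in Ioo z x, c ^ l * u t * Vr r v y t ^ l ≤ Vr r v y x ^ l * c ^ (l + 1) := by
    intro z hz hzc
    calc _ ≤ ∫⁻ t in Ioo z x, c ^ l * Vr r v y x ^ l * u t := by
          refine setLIntegral_mono' measurableSet_Ioo fun t ht => ?_
          rw [mul_right_comm]
          gcongr
          exact Vr_mono hr0 hr1 v le_rfl ht.2.le
      _ ≤ c ^ l * Vr r v y x ^ l * c := by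
          rw [lintegral_const_mul _ hu.meas]
          gcongr
      _ = _ := by
          rw [ENNReal.rpow_add_of_nonneg _ _ hl zero_le_one, ENNReal.rpow_one]
          ring
  rcases le_total (∫⁻ s in Ioo y x, u s) c with h | h
  · exact (hbig y le_rfl h).trans le_add_self
  · obtain ⟨z, hz, hzc⟩ := hu.exists_eq h
    rw [lintegral_Ioo_add_Ioo _ hz.1 hz.2]
    refine add_le_add ?_ (hbig z hz.1 hzc.le)
    refine (lintegral_mono_set (Ioo_subset_Ioo_right hz.2)).trans'
      (setLIntegral_mono' measurableSet_Ioo fun t ht => ?_)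
    gcongr
    rw [← hzc]
    exact lintegral_mono_set (Ioo_subset_Ioo_left ht.2.le)

theorem localInt_le_add {q r : ℝ} (hq0 : 0 < q) (hq1 : q < 1) (hr0 : 0 < r) (hr1 : r ≤ 1)
    {u v : ℝ → ℝ≥0∞} {y x x' : ℝ} (hu : HasTails u y x) (hxx : x ≤ x') :
    localInt q r u v y x' ≤ locConst q r * (localInt q r u v y x +
      Vr r v y x ^ (q / (1 - q)) * (∫⁻ t in Ioo x x', u t) ^ (q / (1 - q) + 1) +
      localInt q r u v x x') := by
  have hl : 0 ≤ q / (1 - q) := div_nonneg hq0.le (by linarith)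
  have h2t : (2 : ℝ≥0∞) ^ (q / (1 - q)) ≠ ∞ := ENNReal.rpow_ne_top_of_nonneg hl (by norm_num)
  have hVm : Measurable fun t => Vr r v y t :=
    Monotone.measurable fun s t hst => Vr_mono hr0 hr1 v le_rfl hst
  have hUm : Measurable fun t => ∫⁻ s in Ioo t x, u s :=
    Antitone.measurable fun s t hst => lintegral_mono_set (Ioo_subset_Ioo_left hst)
  have hUm' : Measurable fun t => ∫⁻ s in Ioo t x', u s :=
    Antitone.measurable fun s t hst => lintegral_mono_set (Ioo_subset_Ioo_left hst)
  set l := q / (1 - q) with hldef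
  set c := ∫⁻ t in Ioo x x', u t with hc
  set D : ℝ≥0∞ := 2 ^ ((1 - r) / r) with hD
  have hDt : D ^ l ≠ ∞ := ENNReal.rpow_ne_top_of_nonneg hl
    (ENNReal.rpow_ne_top_of_nonneg (div_nonneg (by linarith) hr0.le) (by norm_num))
  have h1 : ∫⁻ t in Ioo y x, (∫⁻ s in Ioo t x', u s) ^ l * u t * Vr r v y t ^ l ≤
      2 ^ l * (2 * localInt q r u v y x + Vr r v y x ^ l * c ^ (l + 1)) := by
    calc _ ≤ ∫⁻ t in Ioo y x, 2 ^ l * ((∫⁻ s in Ioo t x, u s) ^ l * u t * Vr r v y t ^ l +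
            c ^ l * u t * Vr r v y t ^ l) := by
          refine setLIntegral_mono' measurableSet_Ioo fun t ht => ?_
          rw [← add_mul, ← add_mul, ← mul_assoc, ← mul_assoc, lintegral_Ioo_add_Ioo u ht.2.le hxx]
          gcongr
          exact rpow_add_le_two_rpow_mul hl _ _
      _ ≤ 2 ^ l * (localInt q r u v y x + (localInt q r u v y x +
            Vr r v y x ^ l * c ^ (l + 1))) := by
          rw [lintegral_const_mul' _ _ h2t, lintegral_add_left
            (f := fun t => (∫⁻ s in Ioo t x, u s) ^ l * u t * Vr r v y t ^ l)
            (((hUm.pow_const _).mul hu.meas).mul (hVm.pow_const _))]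
          exact mul_le_mul_right (add_le_add_right (rpow_mul_lintegral_Vr_le hl hr0 hr1 hu c) _) _
      _ = _ := by ring
  have h2 : ∫⁻ t in Ioo x x', (∫⁻ s in Ioo t x', u s) ^ l * u t * Vr r v y t ^ l ≤
      2 ^ l * D ^ l * (Vr r v y x ^ l * c ^ (l + 1) + localInt q r u v x x') := by
    calc _ ≤ ∫⁻ t in Ioo x x', 2 ^ l * D ^ l * (Vr r v y x ^ l *
            ((∫⁻ s in Ioo t x', u s) ^ l * u t) +
            (∫⁻ s in Ioo t x', u s) ^ l * u t * Vr r v x t ^ l) := by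
          refine setLIntegral_mono' measurableSet_Ioo fun t ht => ?_
          calc _ ≤ (∫⁻ s in Ioo t x', u s) ^ l * u t *
                (D ^ l * (2 ^ l * (Vr r v y x ^ l + Vr r v x t ^ l))) := by
                gcongr
                refine (ENNReal.rpow_le_rpow (Vr_le_add hr0 hr1 v hu.lt.le ht.1.le) hl).trans ?_
                rw [ENNReal.mul_rpow_of_nonneg _ _ hl]
                gcongr
                exact rpow_add_le_two_rpow_mul hl _ _
            _ = _ := by ring
      _ ≤ _ := by
          have hm : Measurable fun t => (∫⁻ s in Ioo t x', u s) ^ l * u t :=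
            (hUm'.pow_const _).mul hu.meas
          rw [lintegral_const_mul' _ _ (ENNReal.mul_ne_top h2t hDt),
            lintegral_add_left (hm.const_mul _), lintegral_const_mul _ hm]
          exact mul_le_mul_right (add_le_add_left (mul_le_mul_right
            (lintegral_rpow_mul_le_rpow_add_one hl hu.meas _ _) _) _) _
  rw [localInt, lintegral_Ioo_add_Ioo _ hu.lt.le hxx]
  refine (add_le_add h1 h2).trans ?_
  rw [locConst]
  calc _ = 2 ^ l * (2 * localInt q r u v y x + (1 + D ^ l) * (Vr r v y x ^ l * c ^ (l + 1)) +
        D ^ l * localInt q r u v x x') := by ring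
    _ ≤ 2 ^ l * ((2 + D ^ l) * localInt q r u v y x +
        (2 + D ^ l) * (Vr r v y x ^ l * c ^ (l + 1)) +
        (2 + D ^ l) * localInt q r u v x x') := by
      gcongr
      · exact le_self_add
      · norm_num
      · exact le_add_self
    _ = _ := by ring

/-- The supremum over `y ∈ [α, x)` of `W(y)^(-μ) localInt(y, x)^m`. -/
def supLoc (m μ q r : ℝ) (u v W : ℝ → ℝ≥0∞) (α x : ℝ) : ℝ≥0∞ :=
  ⨆ y ∈ Ico α x, W y ^ (-μ) * localInt q r u v y x ^ m

theorem le_supLoc {m μ q r : ℝ} {u v W : ℝ → ℝ≥0∞} {α x y : ℝ} (hy : y ∈ Ico α x) :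
    W y ^ (-μ) * localInt q r u v y x ^ m ≤ supLoc m μ q r u v W α x :=
  le_iSup₂ (f := fun y (_ : y ∈ Ico α x) => W y ^ (-μ) * localInt q r u v y x ^ m) y hy

theorem supLoc_mono {m μ q r : ℝ} (hm : 0 ≤ m) (hq0 : 0 < q) (hq1 : q < 1) (hr0 : 0 < r)
    (hr1 : r ≤ 1) {u v W : ℝ → ℝ≥0∞} {α α' x x' : ℝ} (hα : α' ≤ α) (hx : x ≤ x') :
    supLoc m μ q r u v W α x ≤ supLoc m μ q r u v W α' x' := by
  refine iSup₂_le fun t ht => le_trans ?_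
    (le_supLoc (y := t) ⟨hα.trans ht.1, ht.2.trans_le hx⟩)
  gcongr
  exact localInt_mono hq0 hq1 hr0 hr1 u v le_rfl hx

/-- The constant in the recursion for `supLoc`. -/
def supLocConst (p q r : ℝ) : ℝ≥0∞ :=
  (locConst q r * 3) ^ (p * (1 - q) / (p - q))

theorem rpow_neg_le_rpow_neg {x y : ℝ≥0∞} {s : ℝ} (hs : 0 ≤ s) (h : y ≤ x) :
    x ^ (-s) ≤ y ^ (-s) := by
  rw [ENNReal.rpow_neg, ENNReal.rpow_neg]
  gcongr

theorem supLoc_le {p q r : ℝ} (hq0 : 0 < q) (hqp : q < p) (hp1 : p ≤ 1)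
    (hr0 : 0 < r) (hr1 : r ≤ 1) {u v W : ℝ → ℝ≥0∞} {α x x' : ℝ}
    (hu : ∀ y ∈ Ico α x, HasTails u y x) (hxx : x < x') (hαx : α ≤ x)
    (hW : ∀ s ∈ Icc α x', ∀ t ∈ Icc α x', s ≤ t → W t ≤ W s) (hW0 : ∀ t ∈ Icc α x', W t ≠ 0)
    (hWt : ∀ t ∈ Icc α x', W t ≠ ∞) :
    supLoc (p * (1 - q) / (p - q)) (p / (p - q)) q r u v W α x' ≤
      supLocConst p q r * (supLoc (p * (1 - q) / (p - q)) (p / (p - q)) q r u v W α x +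
        ((W x)⁻¹ * supVr p r v W α x ^ (q / (p - q)) *
            (∫⁻ t in Ioo x x', u t) ^ (q / (p - q) + 1) +
          W x' ^ (-(p / (p - q))) * localInt q r u v x x' ^ (p * (1 - q) / (p - q)))) := by
  have hp0 : 0 < p := hq0.trans hqp
  have hpq : 0 < p - q := by linarith
  have hq1 : q < 1 := hqp.trans_le hp1
  have hq1' : 0 < 1 - q := by linarith
  have hl : 0 < q / (p - q) := div_pos hq0 hpq
  have hm : 0 < p * (1 - q) / (p - q) := by positivity
  have hμ : 0 < p / (p - q) := by positivity
  have em1 : q / (1 - q) * (p * (1 - q) / (p - q)) = p * (q / (p - q)) := by field_simp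
  have em2 : (q / (1 - q) + 1) * (p * (1 - q) / (p - q)) = q / (p - q) + 1 := by
    field_simp
    ring
  have em3 : -(p / (p - q)) = -1 + -(q / (p - q)) := by
    field_simp
    ring
  set m := p * (1 - q) / (p - q) with hmdef
  set μ := p / (p - q) with hμdef
  set l := q / (p - q) with hldef
  have hc1 : 1 ≤ supLocConst p q r := by
    refine one_le_rpow_of_one_le (one_le_mul ?_ (by norm_num)) hm.le
    refine one_le_mul (one_le_rpow_of_one_le (by norm_num) (by positivity)) ?_
    exact le_add_right (by norm_num)
  refine iSup₂_le fun y hy => ?_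
  rcases lt_or_ge y x with hyx | hyx
  · have hyx' : y ∈ Ico α x := ⟨hy.1, hyx⟩
    have hyI : y ∈ Icc α x' := ⟨hy.1, hy.2.le⟩
    have hxI : x ∈ Icc α x' := ⟨hαx, hxx.le⟩
    have hL : localInt q r u v y x' ^ m ≤ supLocConst p q r * (localInt q r u v y x ^ m +
        Vr r v y x ^ (p * l) * (∫⁻ t in Ioo x x', u t) ^ (l + 1) + localInt q r u v x x' ^ m) := by
      refine (ENNReal.rpow_le_rpow (localInt_le_add hq0 hq1 hr0 hr1 (hu y hyx') hxx.le)
        hm.le).trans ?_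
      rw [supLocConst, ← hmdef, ENNReal.mul_rpow_of_nonneg _ _ hm.le,
        ENNReal.mul_rpow_of_nonneg _ _ hm.le, mul_assoc]
      gcongr
      refine (rpow_add_add_le_three_rpow_mul hm.le _ _ _).trans (le_of_eq ?_)
      rw [ENNReal.mul_rpow_of_nonneg _ _ hm.le, ← ENNReal.rpow_mul, ← ENNReal.rpow_mul, em1, em2]
    calc W y ^ (-μ) * localInt q r u v y x' ^ m
        ≤ W y ^ (-μ) * (supLocConst p q r * (localInt q r u v y x ^ m +
        Vr r v y x ^ (p * l) * (∫⁻ t in Ioo x x', u t) ^ (l + 1) + localInt q r u v x x' ^ m)) := by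
          gcongr
      _ = supLocConst p q r * (W y ^ (-μ) * localInt q r u v y x ^ m +
            (W y ^ (-μ) * Vr r v y x ^ (p * l) * (∫⁻ t in Ioo x x', u t) ^ (l + 1) +
              W y ^ (-μ) * localInt q r u v x x' ^ m)) := by ring
      _ ≤ _ := by
          refine mul_le_mul_right (add_le_add (le_supLoc hyx') (add_le_add ?_ ?_)) _
          · rw [em3, ENNReal.rpow_add _ _ (hW0 y hyI) (hWt y hyI), ENNReal.rpow_neg_one,
              mul_assoc (W y)⁻¹, ← inv_mul_rpow_rpow _ _ _ hl.le]
            refine mul_le_mul_left (mul_le_mul' (ENNReal.inv_le_inv.2 (hW y hyI x hxI hyx.le))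
              (ENNReal.rpow_le_rpow (le_supVr hyx') hl.le)) _
          · exact mul_le_mul_left (rpow_neg_le_rpow_neg hμ.le
              (hW y hyI x' ⟨hαx.trans hxx.le, le_rfl⟩ hy.2.le)) _
  · refine le_trans ?_ (le_mul_of_one_le_left' hc1)
    refine le_trans ?_ le_add_self
    refine le_trans ?_ le_add_self
    exact mul_le_mul'
      (rpow_neg_le_rpow_neg hμ.le (hW y ⟨hy.1, hy.2.le⟩ x' ⟨hαx.trans hxx.le, le_rfl⟩ hy.2.le))
      (ENNReal.rpow_le_rpow (localInt_mono hq0 hq1 hr0 hr1 u v hyx le_rfl) hm.le)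

theorem exists_blockNorm_le {q r : ℝ} (u v : ℝ → ℝ≥0∞) {x y : ℝ}
    (h : blockNorm q r u v x y ≠ ∞) :
    ∃ f : ℝ → ℝ≥0∞, (Measurable f ∧ (∀ t ∉ Ioo x y, f t = 0) ∧ ∫⁻ t, f t ≤ 1) ∧
      blockNorm q r u v x y ≤ 2 * blockFun q r u v x y f := by
  rcases eq_or_ne (blockNorm q r u v x y) 0 with h0 | h0
  · exact ⟨0, ⟨measurable_zero, by simp, by simp⟩, h0.trans_le zero_le⟩
  · have hlt : blockNorm q r u v x y / 2 < blockNorm q r u v x y := ENNReal.half_lt_self h0 h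
    obtain ⟨f, hf⟩ := lt_iSup_iff.1 (hlt.trans_eq (blockNorm.eq_def q r u v x y))
    obtain ⟨hf', hlt'⟩ := lt_iSup_iff.1 hf
    exact ⟨f, hf', by rw [mul_comm]; exact (ENNReal.div_le_iff (by simp) (by simp)).1 hlt'.le⟩

theorem CesCesIneq.blockNorm_le {p q r : ℝ} (hq0 : 0 < q) (hp0 : 0 < p) (hp1 : p ≤ 1)
    (hr0 : 0 < r) {u v w : ℝ → ℝ≥0∞} {a b : ℝ} {C : ℝ≥0∞} (H : CesCesIneq a b r p q u v w C)
    (hw : Measurable w) {x y : ℝ} (hx : a ≤ x) (hy : y ≤ b) :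
    blockNorm q r u v x y ≤ C ^ q * (∫⁻ s in Ioo x b, w s) ^ (q / p) := by
  refine iSup₂_le fun f hf => ?_
  have h := H.test_le hq0 hp0 hp1 hw 1 (f := fun _ => f) (τ := fun _ => x) (fun _ => hf.1)
    fun _ t ht => hf.2.1 t fun h => ht ⟨h.1, h.2.trans_le hy⟩
  simp only [Finset.sum_range_one] at h
  have hqr : 0 < q / r := div_pos hq0 hr0
  calc blockFun q r u v x y f
      ≤ ∫⁻ t in Ioo a b, (∫⁻ s in Ioo a t, f s ^ r * v s) ^ (q / r) * u t := by
        refine (lintegral_mono_set (Ioo_subset_Ioo hx hy)).trans' (lintegral_mono fun t => ?_)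
        gcongr
    _ ≤ _ := h
    _ ≤ C ^ q * (1 * ∫⁻ s in Ioo x b, w s) ^ (q / p) := by
        gcongr
        exact (ENNReal.rpow_le_rpow hf.2.2 hp0.le).trans_eq (ENNReal.one_rpow _)
    _ = _ := by rw [one_mul]

theorem CesCesIneq.tsum_blockNorm_le {p q r : ℝ} (hq0 : 0 < q) (hqp : q < p) (hp1 : p ≤ 1)
    (hr0 : 0 < r) {u v w : ℝ → ℝ≥0∞} {a b : ℝ} {C : ℝ≥0∞} (hC : C ≠ ∞)
    (H : CesCesIneq a b r p q u v w C) (hu : Measurable u) (hv : Measurable v)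
    {α : ℝ} (hα : a ≤ α) (hw : HasTails w α b) {x : ℕ → ℝ} (hx : IsPartition x α b) :
    ∑' k, (∫⁻ s in Ioo (x k) b, w s) ^ (-(q / (p - q))) *
        blockNorm q r u v (x k) (x (k + 1)) ^ (p / (p - q)) ≤
      (2 * C ^ q) ^ (p / (p - q)) := by
  have hp0 := hq0.trans hqp
  have hpq : 0 < p - q := by linarith
  have hqr : 0 < q / r := div_pos hq0 hr0
  set W : ℕ → ℝ≥0∞ := fun k => ∫⁻ s in Ioo (x k) b, w s with hW
  set N : ℕ → ℝ≥0∞ := fun k => blockNorm q r u v (x k) (x (k + 1)) with hN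
  have hW0 : ∀ k, W k ≠ 0 := fun k => (hw.pos (hx.mem k)).ne'
  have hWt : ∀ k, W k ≠ ∞ := fun k => hw.lintegral_ne_top (hx.le k) _ le_rfl
  have hNt : ∀ k, N k ≠ ∞ := fun k => ((H.blockNorm_le hq0 hp0 hp1 hr0 hw.meas
    (hα.trans (hx.le k)) (hx.lt (k + 1)).le).trans_lt (ENNReal.mul_lt_top
      (ENNReal.rpow_lt_top_of_nonneg hq0.le hC)
      (ENNReal.rpow_lt_top_of_nonneg (by positivity) (hWt k)))).ne
  choose f hf hNf using fun k => exists_blockNorm_le u v (hNt k)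
  set d : ℕ → ℝ≥0∞ := fun k => W k ^ (-(1 / (p - q))) * N k ^ (1 / (p - q)) with hd
  have hdq : ∀ k, d k ^ q * N k = W k ^ (-(q / (p - q))) * N k ^ (p / (p - q)) := fun k => by
    rw [hd, ENNReal.mul_rpow_of_nonneg _ _ hq0.le, ← ENNReal.rpow_mul, ← ENNReal.rpow_mul,
      show p / (p - q) = 1 / (p - q) * q + 1 by field_simp; ring,
      ENNReal.rpow_add_of_nonneg _ _ (by positivity) zero_le_one, ENNReal.rpow_one,
      show -(1 / (p - q)) * q = -(q / (p - q)) by ring, mul_assoc]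
  have hdp : ∀ k, d k ^ p * W k = W k ^ (-(q / (p - q))) * N k ^ (p / (p - q)) := fun k => by
    rw [hd, ENNReal.mul_rpow_of_nonneg _ _ hp0.le, ← ENNReal.rpow_mul, ← ENNReal.rpow_mul,
      show -(q / (p - q)) = -(1 / (p - q)) * p + 1 by field_simp; ring,
      ENNReal.rpow_add _ _ (hW0 k) (hWt k), ENNReal.rpow_one,
      show 1 / (p - q) * p = p / (p - q) by ring]
    ring
  have hdt : ∀ k, W k ^ (-(q / (p - q))) * N k ^ (p / (p - q)) ≠ ∞ := fun k =>
    ENNReal.mul_ne_top (ENNReal.rpow_ne_top_of_ne_zero (hW0 k) (hWt k))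
      (ENNReal.rpow_ne_top_of_nonneg (by positivity) (hNt k))
  refine (tsum_le_rpow_of_sum_le (s := q / p) (X := 2 * C ^ q) hdt ((div_lt_one hp0).2 hqp)
    fun n => ?_).trans_eq (by congr 1; field_simp)
  have h := H.test_le hq0 hp0 hp1 hw.meas n (f := fun k t => d k * f k t) (τ := x)
    (fun k => (hf k).1.const_mul _) fun k t ht => by
      rw [(hf k).2.1 t fun h => ht ⟨h.1, h.2.trans (hx.lt _)⟩, mul_zero]
  calc ∑ k ∈ Finset.range n, W k ^ (-(q / (p - q))) * N k ^ (p / (p - q))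
      ≤ ∑ k ∈ Finset.range n, 2 * ∫⁻ t in Ioo (x k) (x (k + 1)), (∫⁻ s in Ioo a t,
          (∑ k ∈ Finset.range n, d k * f k s) ^ r * v s) ^ (q / r) * u t := by
        refine Finset.sum_le_sum fun k hk => ?_
        calc W k ^ (-(q / (p - q))) * N k ^ (p / (p - q))
            ≤ d k ^ q * (2 * blockFun q r u v (x k) (x (k + 1)) (f k)) := by
              rw [← hdq]
              exact mul_le_mul_right (hNf k) _
          _ = 2 * blockFun q r u v (x k) (x (k + 1)) (fun t => d k * f k t) := by
              rw [blockFun_const_mul hq0 hr0 hu hv _ _ (hf k).1]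
              ring
          _ ≤ _ := by
              refine mul_le_mul_right (lintegral_mono fun t => ?_) _
              refine mul_le_mul_left (ENNReal.rpow_le_rpow ?_ hqr.le) _
              refine (lintegral_mono_set (Ioo_subset_Ioo_left (hα.trans (hx.le k)))).trans
                (lintegral_mono fun s => ?_)
              refine mul_le_mul_left (ENNReal.rpow_le_rpow ?_ hr0.le) _
              exact Finset.single_le_sum (f := fun k => d k * f k s) (fun _ _ => zero_le) hk
    _ ≤ 2 * ∫⁻ t in Ioo a b, (∫⁻ s in Ioo a t,
          (∑ k ∈ Finset.range n, d k * f k s) ^ r * v s) ^ (q / r) * u t := by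
        rw [← Finset.mul_sum]
        refine mul_le_mul_right ((ENNReal.sum_le_tsum _).trans ?_) _
        rw [hx.tsum_lintegral]
        exact lintegral_mono_set (Ioo_subset_Ioo_left hα)
    _ ≤ 2 * (C ^ q * (∑ k ∈ Finset.range n, W k ^ (-(q / (p - q))) * N k ^ (p / (p - q))) ^
          (q / p)) := by
        refine mul_le_mul_right (h.trans ?_) _
        refine mul_le_mul_right (ENNReal.rpow_le_rpow (Finset.sum_le_sum fun k _ => ?_)
          (by positivity)) _
        rw [← hdp, lintegral_const_mul _ (hf k).1]
        refine mul_le_mul_left (ENNReal.rpow_le_rpow ?_ hp0.le) _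
        exact mul_le_of_le_one_right' (hf k).2.2
    _ = _ := by rw [mul_assoc]

/-- The ratio of the levels in the discretization for `supLoc`. -/
def levelConst (p q r : ℝ) : ℝ≥0∞ := 2 * supLocConst p q r + 2

/-- The constant in the necessity part for `supLoc`. -/
def locNecConst (p q r : ℝ) : ℝ≥0∞ :=
  2 * supLocConst p q r * (2 ^ (q / (p - q) + 1) * supNecConst p q r +
    levelConst p q r ^ (p / (p - q)) *
      (supNecConst 1 q r ^ (p * (1 - q) / (p - q)) * 2 ^ (p / (p - q))))

theorem supLocConst_ne_top {p q r : ℝ} (hq0 : 0 < q) (hqp : q < p) (hp1 : p ≤ 1) (hr0 : 0 < r)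
    (hr1 : r ≤ 1) : supLocConst p q r ≠ ∞ := by
  have hp0 := hq0.trans hqp
  have hpq : 0 < p - q := by linarith
  have hq1 : 0 < 1 - q := by linarith
  have h1 : (2 : ℝ≥0∞) ^ (q / (1 - q)) ≠ ∞ :=
    ENNReal.rpow_ne_top_of_nonneg (by positivity) (by norm_num)
  have h2 : ((2 : ℝ≥0∞) ^ ((1 - r) / r)) ^ (q / (1 - q)) ≠ ∞ :=
    ENNReal.rpow_ne_top_of_nonneg (by positivity)
      (ENNReal.rpow_ne_top_of_nonneg (div_nonneg (by linarith) hr0.le) (by norm_num))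
  refine ENNReal.rpow_ne_top_of_nonneg (by positivity) ?_
  rw [locConst]
  finiteness

theorem levelConst_ne_top {p q r : ℝ} (hq0 : 0 < q) (hqp : q < p) (hp1 : p ≤ 1) (hr0 : 0 < r)
    (hr1 : r ≤ 1) : levelConst p q r ≠ ∞ := by
  have := supLocConst_ne_top hq0 hqp hp1 hr0 hr1
  rw [levelConst]
  finiteness

theorem locNecConst_ne_top {p q r : ℝ} (hq0 : 0 < q) (hqp : q < p) (hp1 : p ≤ 1) (hr0 : 0 < r)
    (hr1 : r ≤ 1) : locNecConst p q r ≠ ∞ := by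
  have hp0 := hq0.trans hqp
  have hpq : 0 < p - q := by linarith
  have hq1 : 0 < 1 - q := by linarith
  have h1 := supLocConst_ne_top hq0 hqp hp1 hr0 hr1
  have h2 := supNecConst_ne_top hq0 hqp hr0 hr1
  have h3 : levelConst p q r ^ (p / (p - q)) ≠ ∞ :=
    ENNReal.rpow_ne_top_of_nonneg (by positivity) (levelConst_ne_top hq0 hqp hp1 hr0 hr1)
  have h4 : supNecConst 1 q r ^ (p * (1 - q) / (p - q)) ≠ ∞ :=
    ENNReal.rpow_ne_top_of_nonneg (by positivity)
      (supNecConst_ne_top hq0 (hqp.trans_le hp1) hr0 hr1)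
  have h5 : (2 : ℝ≥0∞) ^ (p / (p - q)) ≠ ∞ :=
    ENNReal.rpow_ne_top_of_nonneg (by positivity) (by norm_num)
  have h6 : (2 : ℝ≥0∞) ^ (q / (p - q) + 1) ≠ ∞ :=
    ENNReal.rpow_ne_top_of_nonneg (by positivity) (by norm_num)
  rw [locNecConst]
  finiteness

theorem CesCesIneq.lintegral_supLoc_le {p q r : ℝ} (hq0 : 0 < q) (hqp : q < p) (hp1 : p ≤ 1)
    (hr0 : 0 < r) (hr1 : r ≤ 1)
    {u v w : ℝ → ℝ≥0∞} {a b : ℝ} {C : ℝ≥0∞} (hC : C ≠ ∞) (H : CesCesIneq a b r p q u v w C)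
    (hu : IsWeight a b u) (hv : IsWeight a b v) (hw : ∀ α ∈ Ioo a b, HasTails w α b) {α : ℝ}
    (hα : α ∈ Ioo a b) :
    ∫⁻ x in Ioo α b, w x * supLoc (p * (1 - q) / (p - q)) (p / (p - q)) q r u v
        (fun t => ∫⁻ s in Ioo t b, w s) α x ≤
      locNecConst p q r * (C ^ q) ^ (p / (p - q)) := by
  have hp0 := hq0.trans hqp
  have hpq : 0 < p - q := by linarith
  have hq1 : q < 1 := hqp.trans_le hp1
  have hq1' : 0 < 1 - q := by linarith
  have hl : 0 < q / (p - q) := div_pos hq0 hpq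
  have hm : 0 < p * (1 - q) / (p - q) := by positivity
  have hμ : 0 < p / (p - q) := by positivity
  have em1 : 1 / (1 - q) * (p * (1 - q) / (p - q)) = p / (p - q) := by field_simp
  have em3 : -(p / (p - q)) = -1 + -(q / (p - q)) := by
    field_simp
    ring
  have hnec := H.lintegral_supVr_le hq0 hqp hp1 hr0 hr1 hC hu hv hw hα
  have hUα := H.hasTails hq0 hp0 hp1 hr0 hC hu hv hw hα
  have hwα := hw α hα
  have hU : ∀ {y x}, α ≤ y → y < x → x ≤ b → HasTails u y x := fun {y x} hy hyx hxb =>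
    hasTails_of_pos hyx hu.1
      (fun t ht => (hu.2 t ⟨hα.1.trans_le (hy.trans ht.1.le), ht.2.trans_le hxb⟩).1)
      (hUα.lintegral_ne_top hy _ hxb).lt_top
  have hKt := levelConst_ne_top hq0 hqp hp1 hr0 hr1
  have hK2 : 2 ≤ levelConst p q r := le_add_self
  have hK0 : levelConst p q r ≠ 0 := fun h => by simp [h] at hK2
  obtain ⟨x, hx, hxl⟩ := hwα.exists_partition hK2 hKt
  have htot := H.tsum_blockNorm_le hq0 hqp hp1 hr0 hC hu.1 hv.1 hα.1.le hwα hx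
  set l := q / (p - q) with hldef
  set m := p * (1 - q) / (p - q) with hmdef
  set μ := p / (p - q) with hμdef
  set W : ℝ → ℝ≥0∞ := fun t => ∫⁻ s in Ioo t b, w s with hW
  have hW0 : ∀ t ∈ Ico α b, W t ≠ 0 := fun t ht => (hwα.pos ht).ne'
  have hWt : ∀ t ∈ Ico α b, W t ≠ ∞ := fun t ht => hwα.lintegral_ne_top ht.1 _ le_rfl
  have hWK : ∀ k, levelConst p q r ^ μ * W (x k) ^ (-μ) = W (x (k + 1)) ^ (-μ) := fun k => by
    rw [show W (x k) = levelConst p q r * W (x (k + 1)) from (hxl k).symm,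
      ENNReal.mul_rpow_of_ne_top hKt (hWt _ (hx.mem _)), ← mul_assoc,
      ← ENNReal.rpow_add _ _ hK0 hKt, add_neg_cancel, ENNReal.rpow_zero, one_mul]
  set s : ℕ → ℝ≥0∞ := fun k => (W (x k))⁻¹ * supVr p r v W α (x k) ^ l *
      (∫⁻ t in Ioo (x k) (x (k + 1)), u t) ^ (l + 1) +
    W (x (k + 1)) ^ (-μ) * localInt q r u v (x k) (x (k + 1)) ^ m with hs
  have hrec : ∀ k, supLoc m μ q r u v W α (x (k + 1)) ≤
      supLocConst p q r * (supLoc m μ q r u v W α (x k) + s k) := fun k =>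
    supLoc_le hq0 hqp hp1 hr0 hr1 (fun y hy => hU hy.1 hy.2 (hx.lt k).le) (hx.lt_succ k) (hx.le k)
      (fun _ _ _ _ hst => lintegral_mono_set (Ioo_subset_Ioo_left hst))
      (fun t ht => hW0 t ⟨ht.1, ht.2.trans_lt (hx.lt _)⟩)
      (fun t ht => hWt t ⟨ht.1, ht.2.trans_lt (hx.lt _)⟩)
  have hfirst : ∀ k, supVr p r v W α (x k) ^ l *
      (∫⁻ t in Ioo (x k) (x (k + 1)), u t) ^ (l + 1) ≤
      2 ^ (l + 1) * ∫⁻ t in Ioo (x k) (x (k + 1)), (∫⁻ s in Ioo t b, u s) ^ l * u t *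
        supVr p r v W α t ^ l := fun k => by
    have hm : Measurable fun t => (∫⁻ s in Ioo t (x (k + 1)), u s) ^ l * u t :=
      ((Antitone.measurable fun y z hyz =>
        lintegral_mono_set (Ioo_subset_Ioo_left hyz)).pow_const _).mul hu.1
    calc _ ≤ supVr p r v W α (x k) ^ l * (2 ^ (l + 1) *
          ∫⁻ t in Ioo (x k) (x (k + 1)), (∫⁻ s in Ioo t (x (k + 1)), u s) ^ l * u t) :=
          mul_le_mul_right ((hU (hx.le k) (hx.lt_succ k) (hx.lt _).le).rpow_le_lintegral hl.le) _
      _ = 2 ^ (l + 1) * ∫⁻ t in Ioo (x k) (x (k + 1)), supVr p r v W α (x k) ^ l *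
          ((∫⁻ s in Ioo t (x (k + 1)), u s) ^ l * u t) := by
          rw [lintegral_const_mul _ hm]
          ring
      _ ≤ _ := by
          refine mul_le_mul_right (setLIntegral_mono' measurableSet_Ioo fun t ht => ?_) _
          rw [mul_comm]
          refine mul_le_mul' (mul_le_mul_left (ENNReal.rpow_le_rpow
            (lintegral_mono_set (Ioo_subset_Ioo_right (hx.lt _).le)) hl.le) _)
            (ENNReal.rpow_le_rpow (supVr_mono hp0.le hr0 hr1 le_rfl ht.1.le) hl.le)
  have hterm : ∀ k, W (x k) * s k ≤
      2 ^ (l + 1) * (∫⁻ t in Ioo (x k) (x (k + 1)), (∫⁻ s in Ioo t b, u s) ^ l * u t *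
        supVr p r v W α t ^ l) +
      levelConst p q r ^ μ * supNecConst 1 q r ^ m *
        (W (x k) ^ (-l) * blockNorm q r u v (x k) (x (k + 1)) ^ μ) := fun k => by
    rw [hs]
    dsimp only
    rw [mul_add, mul_assoc, ← mul_assoc, ENNReal.mul_inv_cancel (hW0 _ (hx.mem k))
      (hWt _ (hx.mem k)), one_mul]
    refine add_le_add (hfirst k) ?_
    have hL : localInt q r u v (x k) (x (k + 1)) ^ m ≤
        supNecConst 1 q r ^ m * blockNorm q r u v (x k) (x (k + 1)) ^ μ := by
      refine (ENNReal.rpow_le_rpow (localInt_le_blockNorm hq0 hq1 hr0 hr1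
        (hU (hx.le k) (hx.lt_succ k) (hx.lt _).le) hv.1 fun t ht => (hv.2 t
          ⟨hα.1.trans_le ((hx.le k).trans ht.1.le), ht.2.trans (hx.lt _)⟩).2.ne) hm.le).trans ?_
      rw [ENNReal.mul_rpow_of_nonneg _ _ hm.le, ← ENNReal.rpow_mul, em1]
    calc _ ≤ W (x k) * (W (x (k + 1)) ^ (-μ) *
          (supNecConst 1 q r ^ m * blockNorm q r u v (x k) (x (k + 1)) ^ μ)) :=
          mul_le_mul_right (mul_le_mul_right hL _) _
      _ = levelConst p q r ^ μ * supNecConst 1 q r ^ m * ((W (x k) * W (x k) ^ (-μ)) *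
          blockNorm q r u v (x k) (x (k + 1)) ^ μ) := by
          rw [← hWK]
          ring
      _ = _ := by
          rw [em3, ENNReal.rpow_add _ _ (hW0 _ (hx.mem k)) (hWt _ (hx.mem k)),
            ENNReal.rpow_neg_one, ← mul_assoc (W (x k)),
            ENNReal.mul_inv_cancel (hW0 _ (hx.mem k)) (hWt _ (hx.mem k)), one_mul]
  calc ∫⁻ t in Ioo α b, w t * supLoc m μ q r u v W α t
      = ∑' k, ∫⁻ t in Ioo (x k) (x (k + 1)), w t * supLoc m μ q r u v W α t :=
        (hx.tsum_lintegral _).symm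
    _ ≤ ∑' k, W (x k) * supLoc m μ q r u v W α (x (k + 1)) := by
        refine ENNReal.tsum_le_tsum fun k => ?_
        calc _ ≤ ∫⁻ t in Ioo (x k) (x (k + 1)), w t * supLoc m μ q r u v W α (x (k + 1)) := by
              refine setLIntegral_mono' measurableSet_Ioo fun t ht => ?_
              exact mul_le_mul_right (supLoc_mono hm.le hq0 hq1 hr0 hr1 le_rfl ht.2.le) _
          _ ≤ _ := by
              rw [lintegral_mul_const _ hwα.meas]
              exact mul_le_mul_left (lintegral_mono_set (Ioo_subset_Ioo_right (hx.lt _).le)) _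
    _ ≤ 2 * supLocConst p q r * ∑' k, W (x k) * s k := by
        refine tsum_mul_le_of_recursion (E := fun k => supLoc m μ q r u v W α (x k)) (fun k => ?_)
          (by simp [supLoc, hx.zero]) hrec
        exact (mul_le_mul_left le_self_add _).trans_eq (hxl k)
    _ ≤ 2 * supLocConst p q r * (2 ^ (l + 1) * (supNecConst p q r * (C ^ q) ^ μ) +
          levelConst p q r ^ μ * supNecConst 1 q r ^ m * (2 * C ^ q) ^ μ) := by
        refine mul_le_mul_right ((ENNReal.tsum_le_tsum hterm).trans ?_) _
        rw [ENNReal.tsum_add, ENNReal.tsum_mul_left, ENNReal.tsum_mul_left, hx.tsum_lintegral]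
        exact add_le_add (mul_le_mul_right hnec _) (mul_le_mul_right htot _)
    _ = _ := by
        rw [locNecConst, ENNReal.mul_rpow_of_nonneg _ _ hμ.le]
        ring

theorem CesCesIneq.int₅_le {p q r : ℝ} (hq0 : 0 < q) (hqp : q < p) (hp1 : p ≤ 1)
    (hr0 : 0 < r) (hr1 : r ≤ 1) {u v w : ℝ → ℝ≥0∞} {a b : ℝ} (hab : a < b) {C : ℝ≥0∞} (hC : C ≠ ∞)
    (H : CesCesIneq a b r p q u v w C)
    (hu : IsWeight a b u) (hv : IsWeight a b v) (hw : ∀ α ∈ Ioo a b, HasTails w α b) :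
    int₅ a b r p q u v w ≤ locNecConst p q r * (C ^ q) ^ (p / (p - q)) := by
  have hp0 := hq0.trans hqp
  have hq1 : q < 1 := hqp.trans_le hp1
  have hm : 0 ≤ p * (1 - q) / (p - q) :=
    div_nonneg (mul_nonneg hp0.le (by linarith)) (by linarith)
  refine lintegral_Ioo_le_of_left_limit hab
    (g := fun α x => w x * supLoc (p * (1 - q) / (p - q)) (p / (p - q)) q r u v
        (fun t => ∫⁻ s in Ioo t b, w s) α x) ?_ ?_ ?_ ?_
  · intro α hα
    exact (hw α hα).meas.mul (Monotone.measurable fun x y hxy =>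
      supLoc_mono hm hq0 hq1 hr0 hr1 le_rfl hxy)
  · intro α _ α' _ h t _
    exact mul_le_mul_right (supLoc_mono hm hq0 hq1 hr0 hr1 h le_rfl) _
  · intro x hx
    simp only [ENNReal.mul_iSup]
    refine iSup₂_mono fun y hy => mul_le_mul_right ?_ _
    exact le_supLoc (W := fun t => ∫⁻ s in Ioo t b, w s) (show y ∈ Ico y x from ⟨le_rfl, hy.2⟩)
  · exact fun α hα => H.lintegral_supLoc_le hq0 hqp hp1 hr0 hr1 hC hu hv hw hα

theorem rpow_le_mul_of_le_mul {p q : ℝ} (hq0 : 0 < q) (hqp : q < p) {I X C : ℝ≥0∞}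
    (h : I ≤ X * (C ^ q) ^ (p / (p - q))) :
    I ^ ((p - q) / (p * q)) ≤ X ^ ((p - q) / (p * q)) * C := by
  have hp0 := hq0.trans hqp
  have hpq : 0 < p - q := by linarith
  have he : 0 ≤ (p - q) / (p * q) := by positivity
  refine (ENNReal.rpow_le_rpow h he).trans_eq ?_
  rw [ENNReal.mul_rpow_of_nonneg _ _ he, ← ENNReal.rpow_mul, ← ENNReal.rpow_mul,
    show q * (p / (p - q) * ((p - q) / (p * q))) = 1 by field_simp, ENNReal.rpow_one]

/-- The factor by which `C₄ + C₅` is controlled by an admissible constant in the inequality. -/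
def necConst (p q r : ℝ) : ℝ≥0∞ :=
  supNecConst p q r ^ ((p - q) / (p * q)) + locNecConst p q r ^ ((p - q) / (p * q))

theorem necConst_ne_top {p q r : ℝ} (hq0 : 0 < q) (hqp : q < p) (hp1 : p ≤ 1) (hr0 : 0 < r)
    (hr1 : r ≤ 1) : necConst p q r ≠ ∞ := by
  have hp0 := hq0.trans hqp
  have hpq : 0 < p - q := by linarith
  have he : 0 ≤ (p - q) / (p * q) := by positivity
  exact ENNReal.add_ne_top.2
    ⟨ENNReal.rpow_ne_top_of_nonneg he (supNecConst_ne_top hq0 hqp hr0 hr1),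
      ENNReal.rpow_ne_top_of_nonneg he (locNecConst_ne_top hq0 hqp hp1 hr0 hr1)⟩

theorem CesCesIneq.add_le {p q r : ℝ} (hq0 : 0 < q) (hqp : q < p) (hp1 : p ≤ 1)
    (hr0 : 0 < r) (hr1 : r ≤ 1) {u v w : ℝ → ℝ≥0∞} {a b : ℝ} (hab : a < b) {C : ℝ≥0∞} (hC : C ≠ ∞)
    (H : CesCesIneq a b r p q u v w C)
    (hu : IsWeight a b u) (hv : IsWeight a b v) (hw : ∀ α ∈ Ioo a b, HasTails w α b) :
    C₄ a b r p q u v w + C₅ a b r p q u v w ≤ necConst p q r * C := by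
  rw [necConst, add_mul, C₄_eq, C₅_eq]
  exact add_le_add
    (rpow_le_mul_of_le_mul hq0 hqp (H.int₄_le hq0 hqp hp1 hr0 hr1 hab hC hu hv hw))
    (rpow_le_mul_of_le_mul hq0 hqp (H.int₅_le hq0 hqp hp1 hr0 hr1 hab hC hu hv hw))

/-- case (v) of the main theorem: for `q < p ≤ r ≤ 1`,
the inequality holds iff `C₄ < ∞` and `C₅ < ∞`, and `C ≈ C₄ + C₅`. -/
theorem main_case_v (p q r : ℝ) (hq0 : 0 < q) (hqp : q < p) (hpr : p ≤ r) (hr1 : r ≤ 1) :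
    ∃ κ₁ κ₂ : ℝ≥0∞, 0 < κ₁ ∧ κ₂ < ∞ ∧
    ∀ (a b : ℝ), a < b → ∀ u v w : ℝ → ℝ≥0∞,
      IsWeight a b u → IsWeight a b v → IsWeight a b w →
      (∀ x ∈ Set.Ioo a b,
        0 < (∫⁻ t in Set.Ioo x b, w t) ∧ (∫⁻ t in Set.Ioo x b, w t) < ∞) →
      (((∃ C : ℝ≥0∞, C < ∞ ∧ CesCesIneq a b r p q u v w C) ↔
          (C₄ a b r p q u v w < ∞ ∧ C₅ a b r p q u v w < ∞)) ∧
        κ₁ * (C₄ a b r p q u v w + C₅ a b r p q u v w) ≤ BestC a b r p q u v w ∧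
        BestC a b r p q u v w ≤ κ₂ * (C₄ a b r p q u v w + C₅ a b r p q u v w)) := by
  have hp1 := hpr.trans hr1
  have hr0 := (hq0.trans hqp).trans_le hpr
  have hnt := necConst_ne_top hq0 hqp hp1 hr0 hr1
  have hst : suffConst p q ^ (1 / q) ≠ ∞ :=
    ENNReal.rpow_ne_top_of_nonneg (by positivity) (suffConst_ne_top hq0 hqp)
  refine ⟨(necConst p q r + 1)⁻¹, suffConst p q ^ (1 / q) + 1,
    ENNReal.inv_pos.2 (by finiteness), by finiteness, fun a b hab u v w hu hv hw hW => ?_⟩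
  have hwt : ∀ α ∈ Ioo a b, HasTails w α b := fun α hα =>
    ⟨hα.2, hw.1, fun {x} hx => (hW x ⟨hα.1.trans_le hx.1, hx.2⟩).1, (hW α hα).2⟩
  refine ⟨⟨fun ⟨C, hC, H⟩ => ?_, fun ⟨h4, h5⟩ => ?_⟩, le_sInf fun C H => ?_, ?_⟩
  · exact ENNReal.add_lt_top.1 ((H.add_le hq0 hqp hp1 hr0 hr1 hab hC.ne hu hv hwt).trans_lt
      (ENNReal.mul_lt_top hnt.lt_top hC))
  · exact ⟨_, ENNReal.mul_lt_top hst.lt_top (ENNReal.add_lt_top.2 ⟨h4, h5⟩),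
      cesCesIneq_of_lt_top hq0 hqp hpr hr1 hab hu hv hwt h4⟩
  · rcases eq_or_ne C ∞ with rfl | hC
    · exact le_top
    rw [mul_comm, ← div_eq_mul_inv]
    refine ENNReal.div_le_of_le_mul' ((H.add_le hq0 hqp hp1 hr0 hr1 hab hC hu hv hwt).trans ?_)
    gcongr
    exact le_self_add
  · rcases eq_or_ne (C₄ a b r p q u v w) ∞ with h4 | h4
    · rw [h4, top_add, ENNReal.mul_top (by simp)]
      exact le_top
    · refine (sInf_le (cesCesIneq_of_lt_top hq0 hqp hpr hr1 hab hu hv hwt h4.lt_top)).trans ?_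
      gcongr
      exact le_self_add
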